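/- arXiv:1410.1591 — 11 statements merged into one kernel-verified Lean document; each statement's English description precedes it below -/
import Mathlib

section
/- Let 𝒜 be a finite set of random events in a probability space Ω. For each A ∈ 𝒜 let Γ(A) ⊆ 𝒜 \ {A} be a set of events such that A is independent from the σ-algebra generated by the events 𝒜 \ (Γ(A) ∪ {A}). Suppose there exists an assignment of reals μ : 𝒜 → [0,1) such that for every A ∈ 𝒜 one has Pr(A) ≤ μ(A) · ∏_{B ∈ Γ(A)} (1 − μ(B)). Then Pr(⋂_{A ∈ 𝒜} Aᶜ) > 0. -/
open MeasureTheory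

/-- If conditionally on avoiding `U ⊂ S` each `A j` has probability at most `μ j`, then avoiding
the events of `T` in addition to those of `R` costs at most a factor `∏ j ∈ T, (1 - μ j)`. -/
theorem prod_one_sub_mul_measureReal_biInter_compl_le {Ω : Type*} [MeasurableSpace Ω]
    (ℙ : Measure Ω) [IsProbabilityMeasure ℙ] {ι : Type*} [DecidableEq ι]
    (A : ι → Set Ω) (hA : ∀ i, MeasurableSet (A i))
    (μ : ι → ℝ) (hμ1 : ∀ i, μ i < 1) (S R : Finset ι)
    (hS : ∀ U, U ⊂ S → ∀ j, ℙ.real (A j ∩ ⋂ k ∈ U, (A k)ᶜ) ≤ μ j * ℙ.real (⋂ k ∈ U, (A k)ᶜ))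
    (T : Finset ι) (hRT : Disjoint R T) (hRS : R ∪ T ⊆ S) :
    (∏ j ∈ T, (1 - μ j)) * ℙ.real (⋂ k ∈ R, (A k)ᶜ) ≤ ℙ.real (⋂ k ∈ R ∪ T, (A k)ᶜ) := by
  induction T using Finset.induction_on with
  | empty => simp
  | insert j T hj ih =>
    rw [Finset.disjoint_insert_right] at hRT
    rw [Finset.union_insert] at hRS ⊢
    have hjU : j ∉ R ∪ T := by simp [hj, hRT.1]
    have hU : R ∪ T ⊂ S := (Finset.ssubset_insert hjU).trans_subset hRS
    have hsplit := measureReal_inter_add_sdiff (μ := ℙ) (s := ⋂ k ∈ R ∪ T, (A k)ᶜ) (hA j)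
    rw [Set.inter_comm, Set.sdiff_eq, Set.inter_comm _ (A j)ᶜ] at hsplit
    rw [Finset.prod_insert hj, Finset.set_biInter_insert, mul_assoc]
    have hstep := mul_le_mul_of_nonneg_left (ih hRT.2 hU.subset) (sub_nonneg.2 (hμ1 j).le)
    linarith [hS _ hU j]

/-- Conditionally on avoiding any finite subfamily, the event `A i` has probability at most
`μ i`. -/
theorem measureReal_inter_biInter_compl_le {Ω : Type*} [MeasurableSpace Ω]
    (ℙ : Measure Ω) [IsProbabilityMeasure ℙ] {ι : Type*} [DecidableEq ι]
    (A : ι → Set Ω) (hA : ∀ i, MeasurableSet (A i)) (Γ : ι → Finset ι)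
    (hindep : ∀ i, ∀ S : Set Ω,
      MeasurableSet[MeasurableSpace.generateFrom {T : Set Ω | ∃ j, j ∉ Γ i ∧ j ≠ i ∧ T = A j}] S →
      ℙ (A i ∩ S) = ℙ (A i) * ℙ S)
    (μ : ι → ℝ) (hμ0 : ∀ i, 0 ≤ μ i) (hμ1 : ∀ i, μ i < 1)
    (hcond : ∀ i, (ℙ (A i)).toReal ≤ μ i * ∏ j ∈ Γ i, (1 - μ j)) (S : Finset ι) (i : ι) :
    ℙ.real (A i ∩ ⋂ k ∈ S, (A k)ᶜ) ≤ μ i * ℙ.real (⋂ k ∈ S, (A k)ᶜ) := by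
  induction S using Finset.strongInduction generalizing i with
  | H S ih =>
    by_cases hi : i ∈ S
    · have hempty : A i ∩ ⋂ k ∈ S, (A k)ᶜ = ∅ := by
        ext x
        simp only [Set.mem_inter_iff, Set.mem_iInter, Set.mem_compl_iff, Set.mem_empty_iff_false,
          iff_false, not_and]
        exact fun hx h => h i hi hx
      rw [hempty, measureReal_empty]
      exact mul_nonneg (hμ0 i) measureReal_nonneg
    · have hunion : S \ Γ i ∪ S ∩ Γ i = S := Finset.sdiff_union_inter S (Γ i)
      have hchain := prod_one_sub_mul_measureReal_biInter_compl_le ℙ A hA μ hμ1 S (S \ Γ i) ih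
        (S ∩ Γ i) (Finset.disjoint_sdiff_inter S (Γ i)) hunion.subset
      rw [hunion] at hchain
      have hprod : ∏ j ∈ Γ i, (1 - μ j) ≤ ∏ j ∈ S ∩ Γ i, (1 - μ j) :=
        Finset.prod_le_prod_of_subset_of_le_one Finset.inter_subset_right
          (fun j _ => sub_nonneg.2 (hμ1 j).le) (fun j _ _ => by linarith [hμ0 j])
      have hmeas : ℙ.real (A i ∩ ⋂ k ∈ S \ Γ i, (A k)ᶜ)
          = ℙ.real (A i) * ℙ.real (⋂ k ∈ S \ Γ i, (A k)ᶜ) := by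
        simp only [measureReal_def, ← ENNReal.toReal_mul]
        congr 1
        refine hindep i _ (Finset.measurableSet_biInter _ fun k hk => ?_)
        rw [Finset.mem_sdiff] at hk
        refine MeasurableSet.compl (MeasurableSpace.measurableSet_generateFrom ?_)
        exact ⟨k, hk.2, fun h => hi (h ▸ hk.1), rfl⟩
      calc ℙ.real (A i ∩ ⋂ k ∈ S, (A k)ᶜ)
          ≤ ℙ.real (A i ∩ ⋂ k ∈ S \ Γ i, (A k)ᶜ) :=
            measureReal_mono (Set.inter_subset_inter_right _
              (Set.biInter_subset_biInter_left Finset.sdiff_subset))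
        _ = ℙ.real (A i) * ℙ.real (⋂ k ∈ S \ Γ i, (A k)ᶜ) := hmeas
        _ ≤ (μ i * ∏ j ∈ Γ i, (1 - μ j)) * ℙ.real (⋂ k ∈ S \ Γ i, (A k)ᶜ) :=
            mul_le_mul_of_nonneg_right (hcond i) measureReal_nonneg
        _ ≤ (μ i * ∏ j ∈ S ∩ Γ i, (1 - μ j)) * ℙ.real (⋂ k ∈ S \ Γ i, (A k)ᶜ) :=
            mul_le_mul_of_nonneg_right (mul_le_mul_of_nonneg_left hprod (hμ0 i))
              measureReal_nonneg
        _ ≤ μ i * ℙ.real (⋂ k ∈ S, (A k)ᶜ) := by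
            rw [mul_assoc]
            exact mul_le_mul_of_nonneg_left hchain (hμ0 i)

/-- **Lovász Local Lemma.**  Let `A i`, `i : ι` (with `ι` finite), be a family of events in
a probability space `Ω`.  For each `i` let `Γ i ⊆ ι \ {i}` be such that `A i` is independent
from the σ-algebra generated by the events `A j`, `j ∉ Γ i ∪ {i}`.  If there is an
assignment `μ : ι → [0,1)` with `Pr(A i) ≤ μ i * ∏_{j ∈ Γ i} (1 - μ j)` for all `i`, then
`Pr(⋂ i, (A i)ᶜ) > 0`. -/
theorem stmt_0 {Ω : Type*} [MeasurableSpace Ω] (ℙ : Measure Ω) [IsProbabilityMeasure ℙ]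
    {ι : Type*} [Fintype ι] (A : ι → Set Ω) (hA : ∀ i, MeasurableSet (A i))
    (Γ : ι → Finset ι) (hΓ : ∀ i, i ∉ Γ i)
    (hindep : ∀ i, ∀ S : Set Ω,
      MeasurableSet[MeasurableSpace.generateFrom {T : Set Ω | ∃ j, j ∉ Γ i ∧ j ≠ i ∧ T = A j}] S →
      ℙ (A i ∩ S) = ℙ (A i) * ℙ S)
    (μ : ι → ℝ) (hμ0 : ∀ i, 0 ≤ μ i) (hμ1 : ∀ i, μ i < 1)
    (hcond : ∀ i, (ℙ (A i)).toReal ≤ μ i * ∏ j ∈ Γ i, (1 - μ j)) :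
    0 < ℙ (⋂ i, (A i)ᶜ) := by
  classical
  have hchain := prod_one_sub_mul_measureReal_biInter_compl_le ℙ A hA μ hμ1 Finset.univ ∅
    (fun U _ => measureReal_inter_biInter_compl_le ℙ A hA Γ hindep μ hμ0 hμ1 hcond U)
    Finset.univ (Finset.disjoint_empty_left _) (Finset.subset_univ _)
  have hpos : 0 < ∏ j, (1 - μ j) := Finset.prod_pos fun j _ => sub_pos.2 (hμ1 j)
  simp only [Finset.notMem_empty, Set.iInter_of_empty, Set.iInter_univ, probReal_univ, mul_one,
    Finset.empty_union, Finset.mem_univ, Set.iInter_true] at hchain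
  exact (ENNReal.toReal_pos_iff.1 (hpos.trans_le hchain)).1
end

section
/- Let 𝒳 be a non-empty set equipped with a σ-algebra Σ and let 𝒢 ∈ Σ. Let M be an at most countable monoid with a generating set B ⊆ M, acting measurably on 𝒳 (i.e., for every α ∈ M the map x ↦ α.x is Σ-measurable), and suppose 𝒢 is invariant under the action: for every x ∈ 𝒢 and α ∈ M, α.x ∈ 𝒢. Let Ω be a probability space and X : Ω → 𝒳 a measurable random variable. For every x ∈ 𝒳 \ 𝒢 and β ∈ B with β.x ∈ 𝒢 choose an element g_β(x) ∈ M so that each map x ↦ g_β(x) is measurable; for β ∈ B and α ∈ M define P(β,α) := sup_{γ ∈ M} Pr( g_β(γ.X) = α | αβγ.X ∈ 𝒢 ), where the event {g_β(γ.X) = α} means {ω : γ.X(ω) ∉ 𝒢, βγ.X(ω) ∈ 𝒢, and g_β(γ.X(ω)) = α}, and the convention Pr(E|F)=0 whenever Pr(F)=0 is used. Suppose that Pr(α.X ∈ 𝒢) > 0 for some α ∈ M, and that there exists a function f : B → ℝ_{>0} such that for every β ∈ B one has f(β) ≥ 1 + Σ_{α ∈ M} P(β,α) · f̲(αβ). Then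 Pr(X ∈ 𝒢) > 0. -/
open MeasureTheory ENNReal

/-- For `f` (positive on the generating set `B`) and `α ∈ M`, `funderline B f α` is
`f̲(α) := inf { ∏_{i=1}^k f(β_i) : β_1, …, β_k ∈ B, β_1 ⋯ β_k = α }`. -/
noncomputable def funderline {M : Type*} [Monoid M] (B : Set M) (f : M → ℝ≥0∞) (α : M) :
    ℝ≥0∞ :=
  ⨅ (l : List M) (_ : ∀ b ∈ l, b ∈ B) (_ : l.prod = α), (l.map f).prod

section LocalAction

variable {M : Type*}

theorem le_mul_funderline [Monoid M] {B : Set M} {f : M → ℝ≥0∞} {α : M} {a c : ℝ≥0∞}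
    (hc : c ≠ 0) (hc' : c ≠ ⊤)
    (h : ∀ l : List M, (∀ b ∈ l, b ∈ B) → l.prod = α → a ≤ c * (l.map f).prod) :
    a ≤ c * funderline B f α := by
  have key : a / c ≤ funderline B f α := by
    refine le_iInf fun l => le_iInf fun hl => le_iInf fun hα => ?_
    rw [ENNReal.div_le_iff hc hc', mul_comm]
    exact h l hl hα
  rwa [ENNReal.div_le_iff hc hc', mul_comm] at key

theorem one_le_prod_map {B : Set M} {f : M → ℝ≥0∞} (hf : ∀ b ∈ B, 1 ≤ f b)
    (l : List M) (hl : ∀ b ∈ l, b ∈ B) : 1 ≤ (l.map f).prod := by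
  induction l with
  | nil => simp
  | cons b l ih =>
    simp only [List.mem_cons, forall_eq_or_imp] at hl
    simpa using mul_le_mul' (hf b hl.1) (ih hl.2)

theorem prod_map_ne_top {B : Set M} {f : M → ℝ≥0∞} (hf : ∀ b ∈ B, f b ≠ ⊤)
    (l : List M) (hl : ∀ b ∈ l, b ∈ B) : (l.map f).prod ≠ ⊤ := by
  induction l with
  | nil => simp
  | cons b l ih =>
    simp only [List.mem_cons, forall_eq_or_imp] at hl
    simpa using ENNReal.mul_ne_top (hf b hl.1) (ih hl.2)

/-- If `q` vanishes at `1` and `q ≤ S · f` along all words in `B`, then the recursion for `q`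
improves this to `q ≤ S · (f - 1)`. -/
theorem add_le_mul_prod_map [Monoid M] {B : Set M} {f : M → ℝ≥0∞} {P : M → M → ℝ≥0∞} {q : M → ℝ≥0∞}
    {S : ℝ≥0∞} (hS : S ≠ 0) (hS' : S ≠ ⊤) (hf_fin : ∀ β ∈ B, f β ≠ ⊤)
    (hineq : ∀ β ∈ B, 1 + ∑' α : M, P β α * funderline B f (α * β) ≤ f β)
    (hq : ∀ β γ, q (β * γ) ≤ q γ + ∑' α, P β α * q (α * β * γ)) (hq_one : q 1 = 0)
    (hbound : ∀ l : List M, (∀ b ∈ l, b ∈ B) → q l.prod ≤ S * (l.map f).prod)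
    (l : List M) (hl : ∀ b ∈ l, b ∈ B) : q l.prod + S ≤ S * (l.map f).prod := by
  induction l with
  | nil => simp [hq_one]
  | cons β l ih =>
    simp only [List.mem_cons, forall_eq_or_imp] at hl
    obtain ⟨hβ, hl⟩ := hl
    set F := (l.map f).prod with hF
    have hF_one : 1 ≤ F :=
      one_le_prod_map (fun b hb => le_self_add.trans (hineq b hb)) l hl
    have hF_top : F ≠ ⊤ := prod_map_ne_top hf_fin l hl
    have hterm (α : M) : q (α * β * l.prod) ≤ S * F * funderline B f (α * β) := by
      refine le_mul_funderline (mul_ne_zero hS (zero_lt_one.trans_le hF_one).ne')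
        (ENNReal.mul_ne_top hS' hF_top) fun l' hl' hα => ?_
      have := hbound (l' ++ l) fun b hb => (List.mem_append.1 hb).elim (hl' b) (hl b)
      rw [List.prod_append, hα, List.map_append, List.prod_append] at this
      rwa [mul_comm (l'.map f).prod, ← mul_assoc S] at this
    simp only [List.prod_cons, List.map_cons]
    calc q (β * l.prod) + S
        ≤ (q l.prod + ∑' α, P β α * q (α * β * l.prod)) + S := by gcongr; exact hq _ _
      _ = (q l.prod + S) + ∑' α, P β α * q (α * β * l.prod) := by ring
      _ ≤ S * F + ∑' α, P β α * (S * F * funderline B f (α * β)) := by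
          gcongr with α
          · exact ih hl
          · exact hterm α
      _ = S * F * (1 + ∑' α, P β α * funderline B f (α * β)) := by
          rw [mul_add, mul_one, ← ENNReal.tsum_mul_left]
          congr 1
          exact tsum_congr fun α => by ring
      _ ≤ S * F * f β := by gcongr; exact hineq β hβ
      _ = S * (f β * F) := by ring

theorem eq_zero_of_recursion [Monoid M] {B : Set M} (hB : Submonoid.closure B = ⊤) {f : M → ℝ≥0∞}
    {P : M → M → ℝ≥0∞} {q : M → ℝ≥0∞} (hf_fin : ∀ β ∈ B, f β ≠ ⊤)
    (hineq : ∀ β ∈ B, 1 + ∑' α : M, P β α * funderline B f (α * β) ≤ f β)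
    (hq : ∀ β γ, q (β * γ) ≤ q γ + ∑' α, P β α * q (α * β * γ)) (hq_one : q 1 = 0)
    (hq_le : ∀ α, q α ≤ 1) (α : M) : q α = 0 := by
  have hone : ∀ l : List M, (∀ b ∈ l, b ∈ B) → 1 ≤ (l.map f).prod :=
    one_le_prod_map fun b hb => le_self_add.trans (hineq b hb)
  have htop := prod_map_ne_top hf_fin
  set S : ℝ≥0∞ := ⨆ (l : List M) (_ : ∀ b ∈ l, b ∈ B), q l.prod / (l.map f).prod with hS_def
  have hS_one : S ≤ 1 := iSup₂_le fun l hl =>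
    ENNReal.div_le_of_le_mul (by simpa using (hq_le _).trans (hone l hl))
  have hS_top : S ≠ ⊤ := ne_top_of_le_ne_top ENNReal.one_ne_top hS_one
  have hbound : ∀ l : List M, (∀ b ∈ l, b ∈ B) → q l.prod ≤ S * (l.map f).prod := fun l hl =>
    (ENNReal.div_le_iff (zero_lt_one.trans_le (hone l hl)).ne' (htop l hl)).1
      (le_iSup₂ (f := fun (l : List M) (_ : ∀ b ∈ l, b ∈ B) => q l.prod / (l.map f).prod) l hl)
  have hS : S = 0 := by
    by_contra hS
    have hs_pos : 0 < S.toReal := ENNReal.toReal_pos hS hS_top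
    have hs_one : S.toReal ≤ 1 := by simpa using ENNReal.toReal_mono ENNReal.one_ne_top hS_one
    have hle : S ≤ ENNReal.ofReal (S.toReal - S.toReal ^ 2 / 2) := by
      refine iSup₂_le fun l hl => ?_
      have hF_top := htop l hl
      have hadd := add_le_mul_prod_map hS hS_top hf_fin hineq hq hq_one hbound l hl
      have hq_top : q l.prod ≠ ⊤ := ne_top_of_le_ne_top ENNReal.one_ne_top (hq_le _)
      have hadd_real := ENNReal.toReal_mono (ENNReal.mul_ne_top hS_top hF_top) hadd
      rw [ENNReal.toReal_add hq_top hS_top, ENNReal.toReal_mul] at hadd_real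
      have hle_real := ENNReal.toReal_mono ENNReal.one_ne_top (hq_le l.prod)
      rw [ENNReal.toReal_one] at hle_real
      have hF_pos : 0 < (l.map f).prod.toReal :=
        ENNReal.toReal_pos (zero_lt_one.trans_le (hone l hl)).ne' hF_top
      rw [← ENNReal.ofReal_toReal
        (ENNReal.div_ne_top hq_top (zero_lt_one.trans_le (hone l hl)).ne'), ENNReal.toReal_div]
      refine ENNReal.ofReal_le_ofReal ((div_le_iff₀ hF_pos).2 ?_)
      rcases le_total (S.toReal * (l.map f).prod.toReal) 2 with h | h <;> nlinarith
    have := ENNReal.toReal_mono ENNReal.ofReal_ne_top hle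
    rw [ENNReal.toReal_ofReal (by nlinarith)] at this
    nlinarith
  obtain ⟨l, hl, rfl⟩ := Submonoid.exists_list_of_mem_closure
    (hB ▸ Submonoid.mem_top α : α ∈ Submonoid.closure B)
  simpa [hS] using hbound l hl

end LocalAction

/-- **The Local Action Lemma.**  Let `𝒳` be a non-empty measurable space, `𝒢` a measurable
subset of `𝒳`, and `M` an at most countable monoid with generating set `B` acting
measurably on `𝒳` with `𝒢` invariant under the action.  Let `X : Ω → 𝒳` be a random
variable on a probability space and, for `x ∉ 𝒢` and `β ∈ B` with `β • x ∈ 𝒢`, let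
`g β x ∈ M` be measurably chosen.  With
`P β α := ⨆ γ, Pr(g_β(γ.X) = α | αβγ.X ∈ 𝒢)` (conditional probabilities in `ℝ≥0∞`, so
that `Pr(E|F) = 0` when `Pr F = 0`), if `Pr(α.X ∈ 𝒢) > 0` for some `α` and there is
`f : B → ℝ_{>0}` with `f β ≥ 1 + Σ_α P β α · f̲(αβ)` for all `β ∈ B`, then
`Pr(X ∈ 𝒢) > 0`. -/
theorem stmt_1 {𝒳 : Type*} [MeasurableSpace 𝒳] [Nonempty 𝒳]
    {M : Type*} [Monoid M] [Countable M] [MulAction M 𝒳]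
    (B : Set M) (hB : Submonoid.closure B = ⊤)
    (haction_meas : ∀ α : M, Measurable fun x : 𝒳 => α • x)
    (𝒢 : Set 𝒳) (h𝒢 : MeasurableSet 𝒢)
    (hinv : ∀ x ∈ 𝒢, ∀ α : M, α • x ∈ 𝒢)
    {Ω : Type*} [MeasurableSpace Ω] (ℙ : Measure Ω) [IsProbabilityMeasure ℙ]
    (X : Ω → 𝒳) (hX : Measurable X)
    (g : M → 𝒳 → M)
    (hg_meas : ∀ β α : M, MeasurableSet {x : 𝒳 | x ∉ 𝒢 ∧ β • x ∈ 𝒢 ∧ g β x = α})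
    (P : M → M → ℝ≥0∞)
    (hP : ∀ β α : M, P β α = ⨆ γ : M,
      ℙ {ω | (γ • X ω ∉ 𝒢 ∧ β • (γ • X ω) ∈ 𝒢 ∧ g β (γ • X ω) = α) ∧
              (α * β * γ) • X ω ∈ 𝒢} /
        ℙ {ω | (α * β * γ) • X ω ∈ 𝒢})
    (hstart : ∃ α : M, 0 < ℙ {ω | α • X ω ∈ 𝒢})
    (f : M → ℝ≥0∞) (hf_pos : ∀ β ∈ B, 0 < f β) (hf_fin : ∀ β ∈ B, f β ≠ ⊤)
    (hineq : ∀ β ∈ B, 1 + ∑' α : M, P β α * funderline B f (α * β) ≤ f β) :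
    0 < ℙ {ω | X ω ∈ 𝒢} := by
  set q : M → ℝ≥0∞ := fun α => ℙ {ω | α • X ω ∈ 𝒢} with hq_def
  have hrec (β γ : M) : q (β * γ) ≤ q γ + ∑' α, P β α * q (α * β * γ) := by
    let E (α : M) : Set Ω :=
      {ω | γ • X ω ∉ 𝒢 ∧ β • (γ • X ω) ∈ 𝒢 ∧ g β (γ • X ω) = α}
    have hcover : {ω | (β * γ) • X ω ∈ 𝒢} ⊆ {ω | γ • X ω ∈ 𝒢} ∪ ⋃ α, E α := by
      intro ω hω
      by_cases h : γ • X ω ∈ 𝒢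
      · exact Or.inl h
      · exact Or.inr (Set.mem_iUnion.2 ⟨_, h, by simpa [mul_smul] using hω, rfl⟩)
    have hE (α : M) : ℙ (E α) ≤ P β α * q (α * β * γ) := by
      have hsub : E α ⊆ {ω | (α * β * γ) • X ω ∈ 𝒢} := fun ω hω => by
        simpa [mul_smul] using hinv _ hω.2.1 α
      by_cases h0 : q (α * β * γ) = 0
      · exact (measure_mono hsub).trans (h0.le.trans zero_le)
      · rw [← ENNReal.div_le_iff h0 (measure_ne_top _ _), hP]
        exact le_iSup_of_le γ <| ENNReal.div_le_div_right
          (measure_mono (Set.subset_inter subset_rfl hsub)) _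
    calc q (β * γ) ≤ q γ + ℙ (⋃ α, E α) := (measure_mono hcover).trans (measure_union_le _ _)
      _ ≤ q γ + ∑' α, ℙ (E α) := by gcongr; exact measure_iUnion_le _
      _ ≤ q γ + ∑' α, P β α * q (α * β * γ) := by gcongr with α; exact hE α
  rw [pos_iff_ne_zero]
  intro h
  obtain ⟨α, hα⟩ := hstart
  exact hα.ne' (eq_zero_of_recursion hB hf_fin hineq hrec (by simpa [hq_def] using h)
    (fun _ => prob_le_one) α)
end

section
/- In the setting of the Local Action Lemma (all its hypotheses holding, including the existence of f : B → ℝ_{>0} with f(β) ≥ 1 + Σ_{α ∈ M} P(β,α)·f̲(αβ) for all β ∈ B), for every α ∈ M one has Pr(X ∈ 𝒢) ≥ Pr(α.X ∈ 𝒢) / f̲(α). -/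
open MeasureTheory ENNReal

/-- A lower bound for all products `∏ f(β_i)` over words representing `α` is a lower bound
for `funderline B f α`. -/
lemma le_funderline {M : Type*} [Monoid M] {B : Set M} {f : M → ℝ≥0∞} {α : M} {c : ℝ≥0∞}
    (h : ∀ l : List M, (∀ b ∈ l, b ∈ B) → l.prod = α → c ≤ (l.map f).prod) :
    c ≤ funderline B f α :=
  le_iInf fun l => le_iInf fun hl => le_iInf fun hα => h l hl hα

/-- `funderline B f` is finite when `B` generates the monoid and `f` is finite on `B`. -/
lemma funderline_ne_top {M : Type*} [Monoid M] {B : Set M} {f : M → ℝ≥0∞}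
    (hB : Submonoid.closure B = ⊤) (hf : ∀ β ∈ B, f β ≠ ⊤) (α : M) :
    funderline B f α ≠ ⊤ := by
  obtain ⟨l, hl, hα⟩ := Submonoid.exists_list_of_mem_closure (hB ▸ Submonoid.mem_top α)
  have hle : funderline B f α ≤ (l.map f).prod :=
    iInf_le_of_le l (iInf_le_of_le hl (iInf_le_of_le hα le_rfl))
  refine ne_top_of_le_ne_top ?_ hle
  clear hle hα
  induction l with
  | nil => simp
  | cons b l ih =>
    simp only [List.map_cons, List.prod_cons]
    exact ENNReal.mul_ne_top (hf b (hl b (by simp))) (ih fun c hc => hl c (by simp [hc]))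

/-- If `p ≤ 1` and `p + 1/n ≤ F (q + 1/n)`, then `p ≤ F (q + 1/(n+1))`. -/
lemma le_mul_add_inv_succ {p q F : ℝ≥0∞} {n : ℕ} (hn : n ≠ 0) (hp : p ≤ 1)
    (h : p + (n : ℝ≥0∞)⁻¹ ≤ F * (q + (n : ℝ≥0∞)⁻¹)) :
    p ≤ F * (q + ((n + 1 : ℕ) : ℝ≥0∞)⁻¹) := by
  have hn0 : (n : ℝ≥0∞) ≠ 0 := by exact_mod_cast hn
  have hs0 : ((n + 1 : ℕ) : ℝ≥0∞) ≠ 0 := by exact_mod_cast n.succ_ne_zero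
  have hst : ((n + 1 : ℕ) : ℝ≥0∞) ≠ ⊤ := ENNReal.natCast_ne_top _
  have hinv : (n : ℝ≥0∞)⁻¹ ≠ ⊤ := ENNReal.inv_ne_top.2 hn0
  rcases le_total ((n + 1 : ℕ) : ℝ≥0∞) F with hF | hF
  · calc p ≤ 1 := hp
      _ = ((n + 1 : ℕ) : ℝ≥0∞) * ((n + 1 : ℕ) : ℝ≥0∞)⁻¹ := (ENNReal.mul_inv_cancel hs0 hst).symm
      _ ≤ F * (q + ((n + 1 : ℕ) : ℝ≥0∞)⁻¹) := mul_le_mul' hF le_add_self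
  · have key : (n : ℝ≥0∞)⁻¹ =
        ((n + 1 : ℕ) : ℝ≥0∞)⁻¹ + ((n + 1 : ℕ) : ℝ≥0∞)⁻¹ * (n : ℝ≥0∞)⁻¹ := by
      calc (n : ℝ≥0∞)⁻¹
          = (((n + 1 : ℕ) : ℝ≥0∞)⁻¹ * ((n + 1 : ℕ) : ℝ≥0∞)) * (n : ℝ≥0∞)⁻¹ := by
            rw [ENNReal.inv_mul_cancel hs0 hst, one_mul]
        _ = ((n + 1 : ℕ) : ℝ≥0∞)⁻¹ * ((n : ℝ≥0∞) * (n : ℝ≥0∞)⁻¹ + (n : ℝ≥0∞)⁻¹) := by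
            push_cast; ring
        _ = _ := by
            rw [ENNReal.mul_inv_cancel hn0 (ENNReal.natCast_ne_top _), mul_add, mul_one]
    refine (ENNReal.add_le_add_iff_right hinv).1 ?_
    calc p + (n : ℝ≥0∞)⁻¹ ≤ F * (q + (n : ℝ≥0∞)⁻¹) := h
      _ = F * (q + ((n + 1 : ℕ) : ℝ≥0∞)⁻¹)
          + F * ((n + 1 : ℕ) : ℝ≥0∞)⁻¹ * (n : ℝ≥0∞)⁻¹ := by
          conv_lhs => rw [key]
          ring
      _ ≤ F * (q + ((n + 1 : ℕ) : ℝ≥0∞)⁻¹) + 1 * (n : ℝ≥0∞)⁻¹ := by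
          gcongr
          exact (mul_le_mul_left hF _).trans_eq (ENNReal.mul_inv_cancel hs0 hst)
      _ = _ := by rw [one_mul]

/-- A comparison principle: a function `p ≤ 1` on the monoid satisfying
`p(βγ) ≤ p(γ) + Σ_α P(β,α) p(αβγ)` for `β ∈ B` obeys `p(δγ) ≤ f̲(δ) (p(γ) + 1/(n+1))` for all
`n`, provided that `1 + Σ_α P(β,α) f̲(αβ) ≤ f(β)` on `B`. -/
lemma le_funderline_mul_add_inv {M : Type*} [Monoid M] {B : Set M} {f : M → ℝ≥0∞}
    {P : M → M → ℝ≥0∞} {p : M → ℝ≥0∞} (hp : ∀ γ, p γ ≤ 1)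
    (hstep : ∀ β ∈ B, ∀ γ, p (β * γ) ≤ p γ + ∑' α, P β α * p (α * β * γ))
    (hineq : ∀ β ∈ B, 1 + ∑' α, P β α * funderline B f (α * β) ≤ f β) (n : ℕ) (δ γ : M) :
    p (δ * γ) ≤ funderline B f δ * (p γ + ((n + 1 : ℕ) : ℝ≥0∞)⁻¹) := by
  have of_words : ∀ n : ℕ, (∀ l : List M, (∀ b ∈ l, b ∈ B) → ∀ γ,
      p (l.prod * γ) ≤ (l.map f).prod * (p γ + ((n + 1 : ℕ) : ℝ≥0∞)⁻¹)) → ∀ δ γ,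
      p (δ * γ) ≤ funderline B f δ * (p γ + ((n + 1 : ℕ) : ℝ≥0∞)⁻¹) := by
    intro n h δ γ
    have h0 : p γ + ((n + 1 : ℕ) : ℝ≥0∞)⁻¹ ≠ 0 := fun h0 =>
      ENNReal.inv_ne_zero.2 (ENNReal.natCast_ne_top (n + 1)) (add_eq_zero.1 h0).2
    have ht : p γ + ((n + 1 : ℕ) : ℝ≥0∞)⁻¹ ≠ ⊤ :=
      ENNReal.add_ne_top.2 ⟨ne_top_of_le_ne_top ENNReal.one_ne_top (hp γ),
        ENNReal.inv_ne_top.2 (by exact_mod_cast n.succ_ne_zero)⟩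
    refine (ENNReal.div_le_iff h0 ht).1 (le_funderline fun l hl hδ => ?_)
    exact (ENNReal.div_le_iff h0 ht).2 (hδ ▸ h l hl γ)
  refine of_words n ?_ δ γ
  clear δ γ
  induction n with
  | zero =>
    intro l hl γ
    have h1 : 1 ≤ (l.map f).prod := List.one_le_prod_of_one_le fun x hx => by
      obtain ⟨b, hb, rfl⟩ := List.mem_map.1 hx
      exact le_self_add.trans (hineq b (hl b hb))
    calc p (l.prod * γ) ≤ 1 * 1 := by simpa using hp _
      _ ≤ _ := mul_le_mul' h1 (by simp)
  | succ n ih =>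
    intro l hl γ
    refine le_mul_add_inv_succ n.succ_ne_zero (hp _) ?_
    have hn := of_words n ih
    clear ih
    set ε : ℝ≥0∞ := ((n + 1 : ℕ) : ℝ≥0∞)⁻¹
    have letter : ∀ β ∈ B, ∀ γ, p (β * γ) + ε ≤ f β * (p γ + ε) := by
      intro β hβ γ
      calc p (β * γ) + ε
          ≤ p γ + ∑' α, P β α * p (α * β * γ) + ε := by gcongr; exact hstep β hβ γ
        _ ≤ p γ + ∑' α, P β α * funderline B f (α * β) * (p γ + ε) + ε := by
            refine add_le_add_left (add_le_add_right (ENNReal.tsum_le_tsum fun α => ?_) _) _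
            rw [mul_assoc (P β α)]
            exact mul_le_mul_right (hn (α * β) γ) _
        _ = (1 + ∑' α, P β α * funderline B f (α * β)) * (p γ + ε) := by
            rw [ENNReal.tsum_mul_right]; ring
        _ ≤ f β * (p γ + ε) := by gcongr; exact hineq β hβ
    induction l with
    | nil => simp
    | cons b l ih =>
      simp only [List.map_cons, List.prod_cons, mul_assoc]
      exact (letter b (hl b (by simp)) _).trans
        (by gcongr; exact ih fun c hc => hl c (by simp [hc]))

/-- **Lower bound on the probability in the Local Action Lemma.**  Let `𝒳` be a non-empty measurable space, `𝒢` a measurable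
subset of `𝒳`, and `M` an at most countable monoid with generating set `B` acting
measurably on `𝒳` with `𝒢` invariant under the action.  Let `X : Ω → 𝒳` be a random
variable on a probability space and, for `x ∉ 𝒢` and `β ∈ B` with `β • x ∈ 𝒢`, let
`g β x ∈ M` be measurably chosen.  With
`P β α := ⨆ γ, Pr(g_β(γ.X) = α | αβγ.X ∈ 𝒢)` (conditional probabilities in `ℝ≥0∞`, so
that `Pr(E|F) = 0` when `Pr F = 0`), if `Pr(α.X ∈ 𝒢) > 0` for some `α` and there is
`f : B → ℝ_{>0}` with `f β ≥ 1 + Σ_α P β α · f̲(αβ)` for all `β ∈ B`, then for every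
`α ∈ M` one has `Pr(X ∈ 𝒢) ≥ Pr(α.X ∈ 𝒢) / f̲(α)` (division in `ℝ≥0∞`). -/
theorem stmt_4 {𝒳 : Type*} [MeasurableSpace 𝒳] [Nonempty 𝒳]
    {M : Type*} [Monoid M] [Countable M] [MulAction M 𝒳]
    (B : Set M) (hB : Submonoid.closure B = ⊤)
    (haction_meas : ∀ α : M, Measurable fun x : 𝒳 => α • x)
    (𝒢 : Set 𝒳) (h𝒢 : MeasurableSet 𝒢)
    (hinv : ∀ x ∈ 𝒢, ∀ α : M, α • x ∈ 𝒢)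
    {Ω : Type*} [MeasurableSpace Ω] (ℙ : Measure Ω) [IsProbabilityMeasure ℙ]
    (X : Ω → 𝒳) (hX : Measurable X)
    (g : M → 𝒳 → M)
    (hg_meas : ∀ β α : M, MeasurableSet {x : 𝒳 | x ∉ 𝒢 ∧ β • x ∈ 𝒢 ∧ g β x = α})
    (P : M → M → ℝ≥0∞)
    (hP : ∀ β α : M, P β α = ⨆ γ : M,
      ℙ {ω | (γ • X ω ∉ 𝒢 ∧ β • (γ • X ω) ∈ 𝒢 ∧ g β (γ • X ω) = α) ∧
              (α * β * γ) • X ω ∈ 𝒢} /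
        ℙ {ω | (α * β * γ) • X ω ∈ 𝒢})
    (hstart : ∃ α : M, 0 < ℙ {ω | α • X ω ∈ 𝒢})
    (f : M → ℝ≥0∞) (hf_pos : ∀ β ∈ B, 0 < f β) (hf_fin : ∀ β ∈ B, f β ≠ ⊤)
    (hineq : ∀ β ∈ B, 1 + ∑' α : M, P β α * funderline B f (α * β) ≤ f β) :
    ∀ α : M, ℙ {ω | α • X ω ∈ 𝒢} / funderline B f α ≤ ℙ {ω | X ω ∈ 𝒢} := by
  set p : M → ℝ≥0∞ := fun γ => ℙ {ω | γ • X ω ∈ 𝒢} with hp_def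
  have hp : ∀ γ, p γ ≤ 1 := fun γ => prob_le_one
  have hstep : ∀ β ∈ B, ∀ γ, p (β * γ) ≤ p γ + ∑' α, P β α * p (α * β * γ) := by
    intro β _ γ
    have hcover : {ω | (β * γ) • X ω ∈ 𝒢} ⊆ {ω | γ • X ω ∈ 𝒢} ∪ ⋃ α : M,
        {ω | (γ • X ω ∉ 𝒢 ∧ β • (γ • X ω) ∈ 𝒢 ∧ g β (γ • X ω) = α) ∧
          (α * β * γ) • X ω ∈ 𝒢} := by
      intro ω hω
      by_cases hγ : γ • X ω ∈ 𝒢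
      · exact Or.inl hγ
      · refine Or.inr (Set.mem_iUnion.2
          ⟨g β (γ • X ω), ⟨hγ, by simpa [mul_smul] using hω, rfl⟩, ?_⟩)
        rw [mul_assoc, mul_smul]
        exact hinv _ hω _
    refine (measure_mono hcover).trans ((measure_union_le _ _).trans ?_)
    gcongr
    refine (measure_iUnion_le _).trans (ENNReal.tsum_le_tsum fun α => ?_)
    rw [hP]
    refine le_trans ?_ (mul_le_mul_left (le_iSup _ γ) _)
    rw [ENNReal.div_mul_cancel']
    · exact fun h0 => measure_mono_null (fun ω hω => hω.2) h0
    · exact fun ht => absurd ht (measure_ne_top _ _)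
  intro α
  have hfin := funderline_ne_top hB hf_fin α
  have hlim : Filter.Tendsto
      (fun n : ℕ => funderline B f α * (p 1 + ((n + 1 : ℕ) : ℝ≥0∞)⁻¹)) Filter.atTop
      (nhds (funderline B f α * (p 1 + 0))) :=
    ENNReal.Tendsto.const_mul (tendsto_const_nhds.add
      (ENNReal.tendsto_inv_nat_nhds_zero.comp (Filter.tendsto_add_atTop_nat 1))) (Or.inr hfin)
  have hle : p α ≤ funderline B f α * (p 1 + 0) := ge_of_tendsto' hlim fun n => by
    simpa using le_funderline_mul_add_inv hp hstep hineq n α 1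
  refine ENNReal.div_le_of_le_mul' ?_
  simpa [hp_def] using hle
end

section
/- Let 𝒜 be a finite set of random events in a probability space Ω. For each A ∈ 𝒜 let Γ(A) ⊆ 𝒜 \ {A} be such that Pr(A) ≥ Pr(A | ⋂_{B ∈ 𝒮} Bᶜ) for every subfamily 𝒮 ⊆ 𝒜 \ (Γ(A) ∪ {A}). Suppose there exists an assignment μ : 𝒜 → [0,1) such that for every A ∈ 𝒜, Pr(A) ≤ μ(A) · ∏_{B ∈ Γ(A)} (1 − μ(B)). Then Pr(⋂_{A ∈ 𝒜} Aᶜ) ≥ ∏_{A ∈ 𝒜} (1 − μ(A)). -/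
open MeasureTheory

/-- If every one-element extension within `R ∪ T` costs at most a factor `w i`, then extending `T`
by `R` costs at most `∏ i ∈ R, w i`. -/
theorem prod_mul_le_of_insert_step {ι : Type*} [DecidableEq ι] (f : Finset ι → ℝ) (w : ι → ℝ)
    (hw : ∀ i, 0 ≤ w i) (R T : Finset ι) (hRT : Disjoint R T)
    (hstep : ∀ S, S ⊂ R ∪ T → ∀ i ∉ S, w i * f S ≤ f (insert i S)) :
    (∏ i ∈ R, w i) * f T ≤ f (R ∪ T) := by
  induction R using Finset.induction_on with
  | empty => simp
  | insert a R ha ih =>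
    rw [Finset.disjoint_insert_left] at hRT
    have hsub : R ∪ T ⊂ insert a R ∪ T := by
      rw [Finset.insert_union]
      exact Finset.ssubset_insert (by simp [ha, hRT.1])
    have hR := ih hRT.2 fun S hS => hstep S (hS.trans hsub)
    rw [Finset.prod_insert ha, Finset.insert_union, mul_assoc]
    exact (mul_le_mul_of_nonneg_left hR (hw a)).trans
      (hstep _ hsub a (by simp [ha, hRT.1]))

/-- Under the hypotheses of the lopsided local lemma, avoiding one more event `A i` costs at most
a factor `1 - μ i`. -/
theorem one_sub_mul_measureReal_biInter_compl_le {Ω : Type*} [MeasurableSpace Ω] (ℙ : Measure Ω)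
    [IsProbabilityMeasure ℙ] {ι : Type*} [DecidableEq ι] (A : ι → Set Ω)
    (hA : ∀ i, MeasurableSet (A i)) (Γ : ι → Finset ι)
    (hlop : ∀ i, ∀ S : Finset ι, (∀ j ∈ S, j ∉ Γ i ∧ j ≠ i) →
      ℙ.real (A i ∩ ⋂ j ∈ S, (A j)ᶜ) ≤ ℙ.real (A i) * ℙ.real (⋂ j ∈ S, (A j)ᶜ))
    (μ : ι → ℝ) (hμ0 : ∀ i, 0 ≤ μ i) (hμ1 : ∀ i, μ i < 1)
    (hcond : ∀ i, ℙ.real (A i) ≤ μ i * ∏ j ∈ Γ i, (1 - μ j)) (S : Finset ι) :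
    ∀ i ∉ S, (1 - μ i) * ℙ.real (⋂ j ∈ S, (A j)ᶜ) ≤ ℙ.real (⋂ j ∈ insert i S, (A j)ᶜ) := by
  induction S using Finset.strongInduction with
  | H S ih =>
    intro i hi
    have hw : ∀ j, 0 ≤ 1 - μ j := fun j => sub_nonneg.2 (hμ1 j).le
    have hunion : S ∩ Γ i ∪ S \ Γ i = S := by
      rw [Finset.union_comm, Finset.sdiff_union_inter]
    have hprod := prod_mul_le_of_insert_step (fun S => ℙ.real (⋂ j ∈ S, (A j)ᶜ))
      (fun j => 1 - μ j) hw (S ∩ Γ i) (S \ Γ i)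
      (Finset.disjoint_sdiff_inter S (Γ i)).symm (by rw [hunion]; exact ih)
    simp only [hunion] at hprod
    have hΓle : ∏ j ∈ Γ i, (1 - μ j) ≤ ∏ j ∈ S ∩ Γ i, (1 - μ j) :=
      Finset.prod_le_prod_of_subset_of_le_one Finset.inter_subset_right (fun j _ => hw j)
        (fun j _ _ => by linarith [hμ0 j])
    have hbad : ℙ.real (A i ∩ ⋂ j ∈ S, (A j)ᶜ) ≤ μ i * ℙ.real (⋂ j ∈ S, (A j)ᶜ) := calc
      ℙ.real (A i ∩ ⋂ j ∈ S, (A j)ᶜ) ≤ ℙ.real (A i ∩ ⋂ j ∈ S \ Γ i, (A j)ᶜ) :=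
        measureReal_mono (Set.inter_subset_inter_right _
          (Set.biInter_subset_biInter_left fun j hj => (Finset.mem_sdiff.1 hj).1))
      _ ≤ ℙ.real (A i) * ℙ.real (⋂ j ∈ S \ Γ i, (A j)ᶜ) :=
        hlop i _ fun j hj => ⟨(Finset.mem_sdiff.1 hj).2,
          fun h => hi (h ▸ (Finset.mem_sdiff.1 hj).1)⟩
      _ ≤ μ i * (∏ j ∈ S ∩ Γ i, (1 - μ j)) * ℙ.real (⋂ j ∈ S \ Γ i, (A j)ᶜ) :=
        mul_le_mul_of_nonneg_right
          ((hcond i).trans (mul_le_mul_of_nonneg_left hΓle (hμ0 i))) measureReal_nonneg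
      _ ≤ μ i * ℙ.real (⋂ j ∈ S, (A j)ᶜ) := by
        rw [mul_assoc]
        exact mul_le_mul_of_nonneg_left hprod (hμ0 i)
    have hsplit := measureReal_inter_add_sdiff (μ := ℙ) (s := ⋂ j ∈ S, (A j)ᶜ) (hA i)
    rw [Set.inter_comm, Set.sdiff_eq, Set.inter_comm _ (A i)ᶜ] at hsplit
    rw [Finset.set_biInter_insert]
    linarith

/-- **Quantitative Lopsided Lovász Local Lemma.**  Let `A i`, `i : ι` (with `ι` finite), be events in a
probability space.  For each `i` let `Γ i ⊆ ι \ {i}` be such that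
`Pr(A i) ≥ Pr(A i | ⋂_{j ∈ S} (A j)ᶜ)` for every `S ⊆ ι \ (Γ i ∪ {i})` (conditional
probabilities, formalized as `Pr(A ∩ F) / Pr F` in `ℝ≥0∞`, are `0` when `Pr F = 0`).
If there is `μ : ι → [0,1)` with `Pr(A i) ≤ μ i * ∏_{j ∈ Γ i} (1 - μ j)` for all `i`,
then `Pr(⋂ i, (A i)ᶜ) ≥ ∏ i (1 - μ i)` (quantitative lopsided Lovász Local Lemma). -/
theorem stmt_5 {Ω : Type*} [MeasurableSpace Ω] (ℙ : Measure Ω) [IsProbabilityMeasure ℙ]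
    {ι : Type*} [Fintype ι] (A : ι → Set Ω) (hA : ∀ i, MeasurableSet (A i))
    (Γ : ι → Finset ι) (hΓ : ∀ i, i ∉ Γ i)
    (hlop : ∀ i, ∀ S : Finset ι, (∀ j ∈ S, j ∉ Γ i ∧ j ≠ i) →
      ℙ (A i ∩ ⋂ j ∈ S, (A j)ᶜ) / ℙ (⋂ j ∈ S, (A j)ᶜ) ≤ ℙ (A i))
    (μ : ι → ℝ) (hμ0 : ∀ i, 0 ≤ μ i) (hμ1 : ∀ i, μ i < 1)
    (hcond : ∀ i, (ℙ (A i)).toReal ≤ μ i * ∏ j ∈ Γ i, (1 - μ j)) :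
    ∏ i, (1 - μ i) ≤ (ℙ (⋂ i, (A i)ᶜ)).toReal := by
  classical
  have hlop' : ∀ i, ∀ S : Finset ι, (∀ j ∈ S, j ∉ Γ i ∧ j ≠ i) →
      ℙ.real (A i ∩ ⋂ j ∈ S, (A j)ᶜ) ≤ ℙ.real (A i) * ℙ.real (⋂ j ∈ S, (A j)ᶜ) := by
    intro i S hS
    rw [Measure.real, Measure.real, Measure.real, ← ENNReal.toReal_mul]
    refine ENNReal.toReal_mono (ENNReal.mul_ne_top (measure_ne_top _ _) (measure_ne_top _ _)) ?_
    exact (ENNReal.div_le_iff_le_mul (Or.inr (measure_ne_top _ _))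
      (Or.inl (measure_ne_top _ _))).1 (hlop i S hS)
  have h := prod_mul_le_of_insert_step (fun S => ℙ.real (⋂ j ∈ S, (A j)ᶜ)) (fun j => 1 - μ j)
    (fun j => sub_nonneg.2 (hμ1 j).le) Finset.univ ∅ (Finset.disjoint_empty_right _)
    fun S _ => one_sub_mul_measureReal_biInter_compl_le ℙ A hA Γ hlop' μ hμ0 hμ1 hcond S
  simpa [Measure.real] using h
end

section
/- For every finite simple graph G with maximum degree Δ ≥ 3, the non-repetitive chromatic number satisfies π(G) ≤ ⌈ Δ² + (3/2^{2/3})·Δ^{5/3} + 2^{2/3}·Δ^{5/3}/(Δ^{1/3} − 2^{1/3}) ⌉. -/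
/-- A vertex coloring `c` of a graph `G` is non-repetitive if there is no path
`v₁, v₂, …, v_{2t}` in `G` (distinct vertices, consecutive ones adjacent) with
`c v_k = c v_{k+t}` for all `1 ≤ k ≤ t`.  Here the path is given by `v : ℕ → V` on the
indices `0, …, 2t - 1`. -/
def NonrepetitiveColoring {V C : Type*} (G : SimpleGraph V) (c : V → C) : Prop :=
  ¬ ∃ (t : ℕ) (v : ℕ → V), 1 ≤ t ∧
      (∀ i j, i < 2 * t → j < 2 * t → i ≠ j → v i ≠ v j) ∧
      (∀ i, i + 1 < 2 * t → G.Adj (v i) (v (i + 1))) ∧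
      (∀ k, k < t → c (v k) = c (v (k + t)))

open Finset

section Repetition

variable {V X : Type*}

/-- `w 0, …, w (2 * t - 1)` is a path of `G` whose two halves are colored alike by `c`. -/
structure IsRepetition (G : SimpleGraph V) (c : V → X) (t : ℕ) (w : ℕ → V) : Prop where
  inj : ∀ i j, i < 2 * t → j < 2 * t → i ≠ j → w i ≠ w j
  adj : ∀ i, i + 1 < 2 * t → G.Adj (w i) (w (i + 1))
  rep : ∀ k, k < t → c (w k) = c (w (k + t))

theorem IsRepetition.congr {G : SimpleGraph V} {c : V → X} {t : ℕ} {w : ℕ → V}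
    (h : IsRepetition G c t w) {w' : ℕ → V} (hw : ∀ i < 2 * t, w' i = w i) :
    IsRepetition G c t w' where
  inj i j hi hj hij := by
    rw [hw i hi, hw j hj]
    exact h.inj i j hi hj hij
  adj i hi := by
    rw [hw i (by omega), hw _ hi]
    exact h.adj i hi
  rep k hk := by
    rw [hw k (by omega), hw _ (by omega)]
    exact h.rep k hk

theorem IsRepetition.congr_color {G : SimpleGraph V} {c c' : V → X} {t : ℕ} {w : ℕ → V}
    (h : IsRepetition G c t w) (hc : ∀ i < 2 * t, c' (w i) = c (w i)) :
    IsRepetition G c' t w where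
  inj := h.inj
  adj := h.adj
  rep k hk := by
    rw [hc k (by omega), hc _ (by omega)]
    exact h.rep k hk

theorem IsRepetition.reverse {G : SimpleGraph V} {c : V → X} {t : ℕ} {w : ℕ → V}
    (h : IsRepetition G c t w) : IsRepetition G c t fun i => w (2 * t - 1 - i) where
  inj i j hi hj hij := h.inj _ _ (by omega) (by omega) (by omega)
  adj i hi := by
    have := (h.adj (2 * t - 1 - (i + 1)) (by omega)).symm
    rwa [show 2 * t - 1 - (i + 1) + 1 = 2 * t - 1 - i by omega] at this
  rep k hk := by
    have := (h.rep (t - 1 - k) (by omega)).symm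
    rwa [show t - 1 - k + t = 2 * t - 1 - k by omega,
      show t - 1 - k = 2 * t - 1 - (k + t) by omega] at this

/-- No repetition of `c` lies inside `S`. -/
def NonrepetitiveOn (G : SimpleGraph V) (S : Finset V) (c : V → X) : Prop :=
  ∀ t w, 1 ≤ t → (∀ i < 2 * t, w i ∈ S) → ¬ IsRepetition G c t w

theorem NonrepetitiveOn.mono {G : SimpleGraph V} {S T : Finset V} {c : V → X}
    (h : NonrepetitiveOn G S c) (hTS : T ⊆ S) : NonrepetitiveOn G T c :=
  fun t w ht hw => h t w ht fun i hi => hTS (hw i hi)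

theorem NonrepetitiveOn.congr {G : SimpleGraph V} {S : Finset V} {c c' : V → X}
    (h : NonrepetitiveOn G S c) (hc : ∀ x ∈ S, c' x = c x) : NonrepetitiveOn G S c' :=
  fun t w ht hw hr => h t w ht hw (hr.congr_color fun i hi => (hc _ (hw i hi)).symm)

end Repetition

section Walks

variable {V : Type*}

/-- Follow the neighbor enumeration `nb` from `v` according to the choices `s`. -/
def follow (nb : V → ℕ → V) (s : ℕ → ℕ) (v : V) : ℕ → V
  | 0 => v
  | k + 1 => nb (follow nb s v k) (s k)

theorem follow_eq {nb : V → ℕ → V} {s : ℕ → ℕ} {u : ℕ → V} {m : ℕ}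
    (h : ∀ k < m, nb (u k) (s k) = u (k + 1)) : ∀ k ≤ m, follow nb s (u 0) k = u k
  | 0, _ => rfl
  | k + 1, hk => by
    rw [follow, follow_eq h k (by omega), h k (by omega)]

/-- The walk passing through `v` at time `i` which follows the choices `s` in both directions. -/
def followFrom (nb : V → ℕ → V) (v : V) (i : ℕ) (s : ℕ → ℕ) (j : ℕ) : V :=
  if i ≤ j then follow nb (fun k => s (i + k)) v (j - i)
  else follow nb (fun k => s (i - 1 - k)) v (i - j)

/-- A finite sequence of choices, extended by `0`. -/
def extendChoices {m d : ℕ} (e : Fin m → Fin d) (k : ℕ) : ℕ :=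
  if h : k < m then e ⟨k, h⟩ else 0

theorem exists_followFrom_eq {G : SimpleGraph V} {nb : V → ℕ → V} {d : ℕ}
    (hnb : ∀ x y, G.Adj x y → ∃ k < d, nb x k = y) {w : ℕ → V} {m i : ℕ} (hi : i ≤ m)
    (hw : ∀ j < m, G.Adj (w j) (w (j + 1))) :
    ∃ e : Fin m → Fin d, ∀ j ≤ m, followFrom nb (w i) i (extendChoices e) j = w j := by
  have key : ∀ j : Fin m, ∃ k : Fin d, if i ≤ (j : ℕ) then nb (w j) k = w (j + 1)
      else nb (w (j + 1)) k = w j := by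
    intro j
    have hadj := hw j j.2
    split_ifs
    · obtain ⟨k, hk, h⟩ := hnb _ _ hadj
      exact ⟨⟨k, hk⟩, h⟩
    · obtain ⟨k, hk, h⟩ := hnb _ _ hadj.symm
      exact ⟨⟨k, hk⟩, h⟩
  choose e he using key
  refine ⟨e, fun j hj => ?_⟩
  unfold followFrom
  split_ifs with hij
  · have := follow_eq (nb := nb) (s := fun k => extendChoices e (i + k))
      (u := fun k => w (i + k)) (m := m - i) (fun k hk => by
        have hk' : i + k < m := by omega
        have := he ⟨i + k, hk'⟩
        simp only [Nat.le_add_right, if_true] at this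
        simpa [extendChoices, hk', add_assoc] using this) (j - i) (by omega)
    simpa [Nat.add_sub_cancel' hij] using this
  · have := follow_eq (nb := nb) (s := fun k => extendChoices e (i - 1 - k))
      (u := fun k => w (i - k)) (m := i) (fun k hk => by
        have hk' : i - 1 - k < m := by omega
        have := he ⟨i - 1 - k, hk'⟩
        simp only [show ¬ i ≤ i - 1 - k by omega, if_false] at this
        rw [show i - 1 - k + 1 = i - k by omega] at this
        simp only [extendChoices, hk', dif_pos]
        rw [this, show i - (k + 1) = i - 1 - k by omega]) (i - j) (by omega)
    simpa [show i - (i - j) = j by omega] using this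

theorem exists_neighbor_enumeration [Fintype V] (G : SimpleGraph V) [DecidableRel G.Adj] :
    ∃ nb : V → ℕ → V, ∀ x y, G.Adj x y → ∃ k < G.maxDegree, nb x k = y := by
  refine ⟨fun x k => (G.neighborFinset x).toList.getD k x, fun x y hxy => ?_⟩
  have hy : y ∈ (G.neighborFinset x).toList := by simpa using hxy
  obtain ⟨k, hk, h⟩ := List.getElem_of_mem hy
  refine ⟨k, ?_, ?_⟩
  · refine lt_of_lt_of_le hk ?_
    simpa using G.degree_le_maxDegree x
  · change (G.neighborFinset x).toList.getD k x = y
    rw [List.getD_eq_getElem _ _ hk, h]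

end Walks

theorem sum_Icc_mul_pow_le {u : ℝ} (hu : 0 < u) (hu1 : u ≤ 1) (n : ℕ) :
    ∑ t ∈ Icc 1 n, (t : ℝ) * (1 - u) ^ (t - 1) ≤ 1 / u ^ 2 := by
  have key : ∀ n : ℕ, ∑ t ∈ Icc 1 n, (t : ℝ) * (1 - u) ^ (t - 1) =
      (1 - (1 - u) ^ n * (1 + n * u)) / u ^ 2 := by
    intro n
    induction n with
    | zero => simp
    | succ n ih =>
      rw [Finset.sum_Icc_succ_top (by omega), ih, Nat.add_sub_cancel]
      push_cast
      field_simp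
      ring
  rw [key]
  have : 0 ≤ (1 - u) ^ n * (1 + n * u) :=
    mul_nonneg (pow_nonneg (by linarith) _) (by positivity)
  gcongr
  linarith

section Counting

variable {V X : Type*} [Fintype V] [Fintype X]

open Classical in
/-- The colorings which are non-repetitive on `S` and constantly `z` outside of `S`. -/
noncomputable def nonrepColorings (G : SimpleGraph V) (z : X) (S : Finset V) : Finset (V → X) :=
  {c | NonrepetitiveOn G S c ∧ ∀ x ∉ S, c x = z}

open Classical in
/-- The extensions to `insert v S` of the colorings which are non-repetitive on `S`. -/
noncomputable def extColorings (G : SimpleGraph V) (z : X) (S : Finset V) (v : V) :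
    Finset (V → X) :=
  {c | NonrepetitiveOn G S c ∧ ∀ x ∉ insert v S, c x = z}

theorem mem_nonrepColorings {G : SimpleGraph V} {z : X} {S : Finset V} {c : V → X} :
    c ∈ nonrepColorings G z S ↔ NonrepetitiveOn G S c ∧ ∀ x ∉ S, c x = z := by
  simp [nonrepColorings]

open Classical in
theorem mem_extColorings {G : SimpleGraph V} {z : X} {S : Finset V} {v : V} {c : V → X} :
    c ∈ extColorings G z S v ↔ NonrepetitiveOn G S c ∧ ∀ x ∉ insert v S, c x = z := by
  simp [extColorings]

open Classical in
theorem card_mul_le_card_extColorings (G : SimpleGraph V) (z : X) {S : Finset V} {v : V}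
    (hv : v ∉ S) :
    #(nonrepColorings G z S) * Fintype.card X ≤ #(extColorings G z S v) := by
  rw [← Finset.card_univ, ← Finset.card_product]
  refine Finset.card_le_card_of_injOn (fun p => Function.update p.1 v p.2) ?_ ?_
  · rintro ⟨c, a⟩ h
    simp only [coe_product, Set.mem_prod, mem_coe, mem_nonrepColorings] at h
    simp only [mem_coe, mem_extColorings]
    refine ⟨h.1.1.congr fun x hx => ?_, fun x hx => ?_⟩
    · rw [Function.update_of_ne (by rintro rfl; exact hv hx)]
    · rw [mem_insert, not_or] at hx
      rw [Function.update_of_ne hx.1, h.1.2 x hx.2]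
  · rintro ⟨c, a⟩ h ⟨c', a'⟩ h' heq
    simp only [coe_product, Set.mem_prod, mem_coe, mem_nonrepColorings] at h h'
    simp only at heq
    refine Prod.ext (funext fun x => ?_) ?_
    · by_cases hx : x = v
      · subst hx
        exact (h.1.2 x hv).trans (h'.1.2 x hv).symm
      · simpa [Function.update_of_ne hx] using congrFun heq x
    · simpa using congrFun heq v

open Classical in
theorem card_repetition_le (G : SimpleGraph V) (z : X) {S : Finset V} {v : V} {t i : ℕ}
    (hi : i < t) {w : ℕ → V} (hwi : w i = v) :
    #{c ∈ extColorings G z S v | IsRepetition G c t w} ≤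
      #(nonrepColorings G z (insert v S \ (range t).image w)) := by
  refine Finset.card_le_card_of_injOn (fun c x => if x ∈ (range t).image w then z else c x) ?_ ?_
  · intro c hc
    simp only [coe_filter, Set.mem_ofPred_eq, mem_extColorings] at hc
    obtain ⟨⟨hc, hz⟩, hr⟩ := hc
    simp only [mem_coe, mem_nonrepColorings]
    have hsub : insert v S \ (range t).image w ⊆ S := by
      intro x hx
      rw [mem_sdiff, mem_insert] at hx
      rcases hx.1 with rfl | h
      · exact absurd (mem_image.2 ⟨i, mem_range.2 hi, hwi⟩) hx.2
      · exact h
    refine ⟨(hc.mono hsub).congr fun x hx => if_neg (mem_sdiff.1 hx).2, fun x hx => ?_⟩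
    split_ifs with h
    · rfl
    · exact hz x fun hx' => hx (mem_sdiff.2 ⟨hx', h⟩)
  · intro c hc c' hc' heq
    simp only [coe_filter, Set.mem_ofPred_eq] at hc hc'
    have off : ∀ x ∉ (range t).image w, c x = c' x := fun x hx => by
      simpa only [if_neg hx] using congrFun heq x
    funext x
    by_cases hx : x ∈ (range t).image w
    · obtain ⟨k, hk, rfl⟩ := mem_image.1 hx
      rw [mem_range] at hk
      rw [hc.2.rep k hk, hc'.2.rep k hk]
      refine off _ fun h => ?_
      obtain ⟨l, hl, h⟩ := mem_image.1 h
      rw [mem_range] at hl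
      exact hc.2.inj l (k + t) (by omega) (by omega) (by omega) h
    · exact off x hx

open Classical in
theorem pow_mul_card_le_of_step {G : SimpleGraph V} {z : X} {β : ℝ} (hβ : 0 ≤ β) {m : ℕ}
    (step : ∀ (T : Finset V) (v : V), v ∉ T → #T < m →
      β * #(nonrepColorings G z T) ≤ #(nonrepColorings G z (insert v T)))
    (T H : Finset V) (hTH : Disjoint T H) (hm : #(T ∪ H) ≤ m) :
    β ^ #H * #(nonrepColorings G z T) ≤ #(nonrepColorings G z (T ∪ H)) := by
  induction H using Finset.induction_on with
  | empty => simp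
  | insert a H ha ih =>
    rw [disjoint_insert_right] at hTH
    have ha' : a ∉ T ∪ H := by simp [ha, hTH.1]
    rw [union_insert, card_insert_of_notMem ha'] at hm
    rw [union_insert, card_insert_of_notMem ha, pow_succ', mul_assoc]
    exact (mul_le_mul_of_nonneg_left (ih hTH.2 (by omega)) hβ).trans (step _ a ha' (by omega))

open Classical in
/-- A coloring that becomes repetitive when `v` is added repeats along one of the walks through
`v` in the first half. -/
theorem extColorings_subset {G : SimpleGraph V} {z : X} {d : ℕ} {nb : V → ℕ → V}
    (hnb : ∀ x y, G.Adj x y → ∃ k < d, nb x k = y) (S : Finset V) (v : V) :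
    extColorings G z S v ⊆ nonrepColorings G z (insert v S) ∪
      (Icc 1 (Fintype.card V)).biUnion fun t => (range t).biUnion fun i =>
        (univ : Finset (Fin (2 * t - 1) → Fin d)).biUnion fun e =>
          {c ∈ extColorings G z S v |
            (∀ j < 2 * t, followFrom nb v i (extendChoices e) j ∈ insert v S) ∧
            followFrom nb v i (extendChoices e) i = v ∧
            IsRepetition G c t (followFrom nb v i (extendChoices e))} := by
  intro c hc
  rw [mem_union, or_iff_not_imp_left]
  intro hcn
  have hc' := mem_extColorings.1 hc
  have : ∃ t w, 1 ≤ t ∧ (∀ i < 2 * t, w i ∈ insert v S) ∧ IsRepetition G c t w := by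
    by_contra! h
    exact hcn (mem_nonrepColorings.2 ⟨h, hc'.2⟩)
  obtain ⟨t, w, ht, hw, hr⟩ := this
  have : ∃ i w, i < t ∧ w i = v ∧ (∀ i < 2 * t, w i ∈ insert v S) ∧ IsRepetition G c t w := by
    have hv : ∃ i < 2 * t, w i = v := by
      by_contra! h
      exact hc'.1 t w ht (fun i hi => (mem_insert.1 (hw i hi)).resolve_left (h i hi)) hr
    obtain ⟨i, hi, hiv⟩ := hv
    by_cases hit : i < t
    · exact ⟨i, w, hit, hiv, hw, hr⟩
    · refine ⟨2 * t - 1 - i, _, by omega, ?_, fun j hj => hw _ (by omega), hr.reverse⟩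
      rw [show 2 * t - 1 - (2 * t - 1 - i) = i by omega, hiv]
  obtain ⟨i, w, hit, hiv, hw, hr⟩ := this
  have htn : 2 * t ≤ Fintype.card V := by
    have := Fintype.card_le_of_injective (fun k : Fin (2 * t) => w k) (fun a b hab => by
      by_contra h
      exact hr.inj a b a.2 b.2 (fun h' => h (Fin.ext h')) hab)
    simpa using this
  obtain ⟨e, he⟩ := exists_followFrom_eq hnb (w := w) (m := 2 * t - 1) (i := i) (by omega)
    fun j hj => hr.adj j (by omega)
  rw [hiv] at he
  simp only [mem_biUnion, mem_Icc, mem_range, mem_univ, true_and, mem_filter]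
  refine ⟨t, ⟨ht, by omega⟩, i, hit, e, hc, fun j hj => ?_, ?_, hr.congr fun j hj => he j (by omega)⟩
  · rw [he j (by omega)]
    exact hw j hj
  · rw [he i (by omega), hiv]

open Classical in
theorem mul_card_le_card_insert {G : SimpleGraph V} [DecidableRel G.Adj] {z : X} {u : ℝ}
    (hu : 0 < u) (hu1 : u < 1) (hd : 0 < G.maxDegree)
    (hX : (G.maxDegree : ℝ) ^ 2 / (1 - u) + G.maxDegree / u ^ 2 ≤ Fintype.card X) :
    ∀ (m : ℕ) (S : Finset V) (v : V), v ∉ S → #S < m →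
      (G.maxDegree : ℝ) ^ 2 / (1 - u) * #(nonrepColorings G z S) ≤
        #(nonrepColorings G z (insert v S)) := by
  intro m
  induction m with
  | zero => intro S v _ h; omega
  | succ m step =>
  intro S v hv hm
  set d := G.maxDegree
  have hd' : (0 : ℝ) < d := by exact_mod_cast hd
  have hu' : 0 < 1 - u := by linarith
  set β : ℝ := (d : ℝ) ^ 2 / (1 - u) with hβ
  have hβ0 : 0 < β := by positivity
  obtain ⟨nb, hnb⟩ := exists_neighbor_enumeration G
  set L : ℝ := (#(nonrepColorings G z S) : ℝ) with hL
  have single : ∀ t i : ℕ, i < t → ∀ w : ℕ → V,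
      (#{c ∈ extColorings G z S v | (∀ j < 2 * t, w j ∈ insert v S) ∧ w i = v ∧
        IsRepetition G c t w} : ℝ) ≤ L / β ^ (t - 1) := by
    intro t i hi w
    rw [le_div_iff₀ (by positivity)]
    rcases Finset.eq_empty_or_nonempty {c ∈ extColorings G z S v |
        (∀ j < 2 * t, w j ∈ insert v S) ∧ w i = v ∧ IsRepetition G c t w} with h0 | ⟨c, hc⟩
    · rw [h0]
      simp [hL]
    obtain ⟨-, hwS, hwi, hr⟩ := (mem_filter.1 hc)
    have h1 : #{c ∈ extColorings G z S v | (∀ j < 2 * t, w j ∈ insert v S) ∧ w i = v ∧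
        IsRepetition G c t w} ≤ #(nonrepColorings G z (insert v S \ (range t).image w)) :=
      (card_le_card (monotone_filter_right _ fun _ _ h => h.2.2)).trans
        (card_repetition_le G z hi hwi)
    have hvI : v ∈ (range t).image w := mem_image.2 ⟨i, mem_range.2 hi, hwi⟩
    have hIS : (range t).image w ⊆ insert v S := by
      intro x hx
      obtain ⟨k, hk, rfl⟩ := mem_image.1 hx
      exact hwS k (by have := mem_range.1 hk; omega)
    have hcard : #(((range t).image w).erase v) = t - 1 := by
      rw [card_erase_of_mem hvI, card_image_of_injOn, card_range]
      intro a ha b hb hab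
      simp only [coe_range, Set.mem_Iio] at ha hb
      by_contra h
      exact hr.inj a b (by omega) (by omega) h hab
    have hunion : insert v S \ (range t).image w ∪ ((range t).image w).erase v = S := by
      ext x
      simp only [mem_union, mem_sdiff, mem_erase, mem_insert]
      constructor
      · rintro (⟨rfl | h, h'⟩ | ⟨hne, h⟩)
        · exact absurd hvI h'
        · exact h
        · exact (mem_insert.1 (hIS h)).resolve_left hne
      · intro hx
        by_cases h : x ∈ (range t).image w
        · exact Or.inr ⟨by rintro rfl; exact hv hx, h⟩
        · exact Or.inl ⟨Or.inr hx, h⟩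
    have h2 := pow_mul_card_le_of_step hβ0.le step (insert v S \ (range t).image w)
      (((range t).image w).erase v)
      (disjoint_sdiff_self_left.mono_right (erase_subset _ _)) (by rw [hunion]; omega)
    rw [hunion, hcard] at h2
    have h1' : (#{c ∈ extColorings G z S v | (∀ j < 2 * t, w j ∈ insert v S) ∧ w i = v ∧
        IsRepetition G c t w} : ℝ) ≤ #(nonrepColorings G z (insert v S \ (range t).image w)) := by
      exact_mod_cast h1
    calc _ ≤ (#(nonrepColorings G z (insert v S \ (range t).image w)) : ℝ) * β ^ (t - 1) := by
          gcongr
      _ ≤ L := by rw [mul_comm]; exact h2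
  have hE : L * Fintype.card X ≤ #(extColorings G z S v) := by
    rw [hL]
    exact_mod_cast card_mul_le_card_extColorings G z hv
  have hsub := (card_le_card (extColorings_subset (z := z) hnb S v)).trans (card_union_le _ _)
  have hbad : ((#((Icc 1 (Fintype.card V)).biUnion fun t => (range t).biUnion fun i =>
        (univ : Finset (Fin (2 * t - 1) → Fin d)).biUnion fun e =>
          {c ∈ extColorings G z S v |
            (∀ j < 2 * t, followFrom nb v i (extendChoices e) j ∈ insert v S) ∧
            followFrom nb v i (extendChoices e) i = v ∧
            IsRepetition G c t (followFrom nb v i (extendChoices e))}) : ℕ) : ℝ) ≤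
      L * (d / u ^ 2) := by
    calc _ ≤ ∑ t ∈ Icc 1 (Fintype.card V), ∑ i ∈ range t,
            ∑ e : Fin (2 * t - 1) → Fin d, L / β ^ (t - 1) := by
          refine (Nat.cast_le.2 card_biUnion_le).trans ?_
          rw [Nat.cast_sum]
          refine sum_le_sum fun t _ => ?_
          refine (Nat.cast_le.2 card_biUnion_le).trans ?_
          rw [Nat.cast_sum]
          refine sum_le_sum fun i hi => ?_
          refine (Nat.cast_le.2 card_biUnion_le).trans ?_
          rw [Nat.cast_sum]
          exact sum_le_sum fun e _ => single t i (mem_range.1 hi) _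
      _ = ∑ t ∈ Icc 1 (Fintype.card V), L * d * (t * (1 - u) ^ (t - 1)) := by
          refine sum_congr rfl fun t ht => ?_
          obtain ⟨k, rfl⟩ : ∃ k, t = k + 1 := ⟨t - 1, by have := (mem_Icc.1 ht).1; omega⟩
          simp only [sum_const, card_univ, Fintype.card_fun, Fintype.card_fin, card_range,
            nsmul_eq_mul, Nat.add_sub_cancel, Nat.cast_pow]
          rw [show 2 * (k + 1) - 1 = 2 * k + 1 by omega, hβ, div_pow, pow_succ, pow_mul]
          field_simp
      _ = L * d * ∑ t ∈ Icc 1 (Fintype.card V), (t * (1 - u) ^ (t - 1) : ℝ) := by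
          rw [mul_sum]
      _ ≤ L * d * (1 / u ^ 2) := by
          gcongr
          exact sum_Icc_mul_pow_le hu hu1.le _
      _ = L * (d / u ^ 2) := by ring
  have hsub' : (#(extColorings G z S v) : ℝ) ≤ #(nonrepColorings G z (insert v S)) +
      L * (d / u ^ 2) := by
    refine le_trans ?_ (add_le_add_right hbad _)
    exact_mod_cast hsub
  have hLX : L * (β + d / u ^ 2) ≤ L * Fintype.card X := by gcongr
  linarith

/-- The counting bound: `Δ² / (1 - u) + Δ / u²` colors suffice. -/
theorem exists_nonrepetitiveColoring_of_card [Nonempty X] (G : SimpleGraph V) [DecidableRel G.Adj]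
    {u : ℝ} (hu : 0 < u) (hu1 : u < 1) (hd : 0 < G.maxDegree)
    (hX : (G.maxDegree : ℝ) ^ 2 / (1 - u) + G.maxDegree / u ^ 2 ≤ Fintype.card X) :
    ∃ c : V → X, NonrepetitiveColoring G c := by
  classical
  obtain ⟨z⟩ := ‹Nonempty X›
  have hu' : 0 < 1 - u := by linarith
  have hd' : (0 : ℝ) < G.maxDegree := by exact_mod_cast hd
  have pos : ∀ S : Finset V, (0 : ℝ) < #(nonrepColorings G z S) := by
    intro S
    induction S using Finset.induction_on with
    | empty =>
      rw [Nat.cast_pos, card_pos]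
      refine ⟨fun _ => z, mem_nonrepColorings.2 ⟨fun t w ht hw => ?_, fun _ _ => rfl⟩⟩
      exact absurd (hw 0 (by omega)) (notMem_empty _)
    | insert v S hv ih =>
      refine lt_of_lt_of_le ?_
        (mul_card_le_card_insert (z := z) hu hu1 hd hX _ S v hv (Nat.lt_succ_self _))
      positivity
  have h := pos univ
  rw [Nat.cast_pos, card_pos] at h
  obtain ⟨c, hc⟩ := h
  refine ⟨c, fun ⟨t, w, ht, h1, h2, h3⟩ => ?_⟩
  exact (mem_nonrepColorings.1 hc).1 t w ht (fun _ _ => mem_univ _) ⟨h1, h2, h3⟩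

end Counting

theorem color_bound_eq {x a : ℝ} (ha : 0 < a) (hax : a < x) (ha3 : a ^ 3 = 2) :
    (x ^ 3) ^ 2 / (1 - a / x) + x ^ 3 / (a / x) ^ 2 =
      (x ^ 3) ^ 2 + 3 / a ^ 2 * x ^ 5 + a ^ 2 * x ^ 5 / (x - a) := by
  have hx : 0 < x := ha.trans hax
  have h1 : x - a ≠ 0 := (sub_pos.2 hax).ne'
  have h2 : 1 - a / x ≠ 0 := by
    rw [one_sub_div hx.ne']
    exact div_ne_zero h1 hx.ne'
  rw [one_sub_div hx.ne']
  field_simp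
  linear_combination (x - a) * ha3

/-- For every finite simple graph `G` with maximum degree `Δ ≥ 3`, the non-repetitive
chromatic number satisfies
`π(G) ≤ ⌈Δ² + (3/2^{2/3})·Δ^{5/3} + 2^{2/3}·Δ^{5/3}/(Δ^{1/3} − 2^{1/3})⌉`,
i.e. there is a non-repetitive coloring of `G` with that many colors. -/
theorem stmt_7 {V : Type*} [Fintype V] (G : SimpleGraph V) [DecidableRel G.Adj]
    (hΔ : 3 ≤ G.maxDegree) :
    ∃ c : V → Fin ⌈((G.maxDegree : ℝ) ^ 2
        + 3 / (2 : ℝ) ^ ((2 : ℝ) / 3) * (G.maxDegree : ℝ) ^ ((5 : ℝ) / 3)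
        + (2 : ℝ) ^ ((2 : ℝ) / 3) * (G.maxDegree : ℝ) ^ ((5 : ℝ) / 3)
          / ((G.maxDegree : ℝ) ^ ((1 : ℝ) / 3) - (2 : ℝ) ^ ((1 : ℝ) / 3)))⌉₊,
      NonrepetitiveColoring G c := by
  set d := G.maxDegree with hd
  have hd0 : (0 : ℝ) ≤ d := Nat.cast_nonneg d
  set x : ℝ := (d : ℝ) ^ ((1 : ℝ) / 3) with hx
  set a : ℝ := (2 : ℝ) ^ ((1 : ℝ) / 3) with ha
  have ha0 : 0 < a := by positivity
  have hax : a < x := by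
    refine Real.rpow_lt_rpow (by norm_num) ?_ (by norm_num)
    have : (3 : ℝ) ≤ d := by exact_mod_cast hΔ
    linarith
  have hx0 : 0 < x := ha0.trans hax
  have hx3 : x ^ 3 = d := by
    rw [hx, ← Real.rpow_natCast, ← Real.rpow_mul hd0]
    norm_num
  have ha3 : a ^ 3 = 2 := by
    rw [ha, ← Real.rpow_natCast, ← Real.rpow_mul (by norm_num)]
    norm_num
  have hx5 : (d : ℝ) ^ ((5 : ℝ) / 3) = x ^ 5 := by
    rw [hx, ← Real.rpow_natCast, ← Real.rpow_mul hd0]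
    norm_num
  have ha2 : (2 : ℝ) ^ ((2 : ℝ) / 3) = a ^ 2 := by
    rw [ha, ← Real.rpow_natCast, ← Real.rpow_mul (by norm_num)]
    norm_num
  have hbound := color_bound_eq ha0 hax ha3
  rw [hx3] at hbound
  rw [hx5, ha2, ← hbound]
  have hu1 : a / x < 1 := (div_lt_one hx0).2 hax
  have hd' : (0 : ℝ) < d := by exact_mod_cast (by omega : 0 < d)
  have hpos : 0 < (d : ℝ) ^ 2 / (1 - a / x) + d / (a / x) ^ 2 := by
    have : 0 < 1 - a / x := by linarith
    positivity
  have : Nonempty (Fin ⌈(d : ℝ) ^ 2 / (1 - a / x) + d / (a / x) ^ 2⌉₊) :=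
    ⟨⟨0, Nat.ceil_pos.2 hpos⟩⟩
  exact exists_nonrepetitiveColoring_of_card G (div_pos ha0 hx0) hu1 (by omega)
    (by rw [Fintype.card_fin]; exact Nat.le_ceil _)
end

section
/- For every finite simple graph G with maximum degree Δ ≥ 2, the acyclic chromatic index satisfies a′(G) ≤ 4(Δ − 1). -/
/-- An edge coloring `c` (a function on `Sym2 V`, only its values on edges of `G` being
relevant) of a graph `G` is a proper edge coloring if distinct edges sharing an endpoint
receive different colors. -/
def IsProperEdgeColoring {V C : Type*} (G : SimpleGraph V) (c : Sym2 V → C) : Prop :=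
  ∀ e₁ ∈ G.edgeSet, ∀ e₂ ∈ G.edgeSet, e₁ ≠ e₂ → (∃ v, v ∈ e₁ ∧ v ∈ e₂) → c e₁ ≠ c e₂

/-- A proper edge coloring is acyclic if every cycle of `G` contains edges of at least
three different colors (no bichromatic cycle). -/
def IsAcyclicEdgeColoring {V C : Type*} [DecidableEq C] (G : SimpleGraph V)
    (c : Sym2 V → C) : Prop :=
  IsProperEdgeColoring G c ∧
    ∀ (u : V) (p : G.Walk u u), p.IsCycle → 3 ≤ (p.edges.map c).toFinset.card

/-- The `i`-th edge of a bi-infinite vertex sequence. -/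
def seqEdge {V : Type*} (x : ℤ → V) (i : ℤ) : Sym2 V := s(x i, x (i + 1))

/-- A bi-infinite vertex sequence that winds around a cyclic sequence of `n` distinct
vertices. -/
def IsCyclicSeq {V : Type*} (n : ℕ) (x : ℤ → V) : Prop := ∀ i j, x i = x j ↔ (n : ℤ) ∣ i - j

/-- The coloring `c` takes the same value on any two edges of the sequence at distance two. -/
def IsAlternating {V C : Type*} (c : Sym2 V → C) (x : ℤ → V) : Prop :=
  ∀ i, c (seqEdge x i) = c (seqEdge x (i + 2))

/-- The coloring `c` is proper on `S`, and no cycle with edges in `S` alternates. -/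
def ValidOn {V C : Type*} (S : Finset (Sym2 V)) (c : Sym2 V → C) : Prop :=
  (∀ a b d, s(a, b) ∈ S → s(a, d) ∈ S → b ≠ d → c s(a, b) ≠ c s(a, d)) ∧
    ∀ (n : ℕ) (x : ℤ → V), 3 ≤ n → IsCyclicSeq n x → (∀ i, seqEdge x i ∈ S) →
      ¬ IsAlternating c x

open Classical in
/-- The colorings of all pairs of vertices that are valid on `S`. -/
noncomputable def validColorings {V : Type*} [Fintype V] [DecidableEq V] (K : ℕ)
    (S : Finset (Sym2 V)) : Finset (Sym2 V → Fin K) :=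
  Finset.univ.filter (ValidOn S)

/-- Giving the pair `uv` its current color creates a conflict at `u` or `v`, or an
alternating 4-cycle. -/
def HasLocalConflict {V C : Type*} (S : Finset (Sym2 V)) (u v : V) (c : Sym2 V → C) : Prop :=
  (∃ y, s(u, y) ∈ S ∧ c s(u, y) = c s(u, v)) ∨ (∃ x, s(v, x) ∈ S ∧ c s(v, x) = c s(u, v)) ∨
    ∃ x y, s(v, x) ∈ S ∧ s(u, y) ∈ S ∧ s(x, y) ∈ S ∧ c s(v, x) = c s(u, y) ∧
      c s(x, y) = c s(u, v)

/-- An alternating cycle of length `n` in `S ∪ {uv}` that starts by going from `u` to `v`. -/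
structure IsAlternatingThrough {V C : Type*} (S : Finset (Sym2 V)) (u v : V) (n : ℕ)
    (c : Sym2 V → C) (x : ℤ → V) : Prop where
  cyclic : IsCyclicSeq n x
  zero : x 0 = u
  one : x 1 = v
  mem : ∀ i, seqEdge x i = s(u, v) ∨ seqEdge x i ∈ S
  alternating : IsAlternating c x

section Sequences

variable {V C : Type*}

theorem IsCyclicSeq.seqEdge_eq_iff {n : ℕ} (hn : 3 ≤ n) {x : ℤ → V} (hx : IsCyclicSeq n x)
    (i j : ℤ) : seqEdge x i = seqEdge x j ↔ (n : ℤ) ∣ i - j := by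
  unfold seqEdge
  rw [Sym2.eq_iff, hx, hx, hx, hx]
  constructor
  · rintro (⟨h, -⟩ | ⟨h₁, h₂⟩)
    · exact h
    · exfalso
      have h : (n : ℤ) ∣ 2 := by
        have := dvd_sub h₂ h₁
        ring_nf at this
        exact this
      have := Int.le_of_dvd (by norm_num) h
      omega
  · intro h
    exact Or.inl ⟨h, by simpa using h⟩

theorem IsCyclicSeq.shift {n : ℕ} {x : ℤ → V} (hx : IsCyclicSeq n x) (k : ℤ) :
    IsCyclicSeq n fun i => x (k + i) := by
  intro i j
  simp [hx (k + i) (k + j)]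

theorem IsCyclicSeq.reflect {n : ℕ} {x : ℤ → V} (hx : IsCyclicSeq n x) (k : ℤ) :
    IsCyclicSeq n fun i => x (k - i) := by
  intro i j
  simp only [hx (k - i) (k - j)]
  rw [← dvd_neg]
  ring_nf

theorem seqEdge_shift (x : ℤ → V) (k i : ℤ) :
    seqEdge (fun i => x (k + i)) i = seqEdge x (k + i) := by
  simp [seqEdge, add_assoc]

theorem seqEdge_reflect (x : ℤ → V) (k i : ℤ) :
    seqEdge (fun i => x (k - i)) i = seqEdge x (k - i - 1) := by
  unfold seqEdge
  rw [Sym2.eq_swap]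
  congr 3 <;> ring_nf

theorem IsAlternating.shift {c : Sym2 V → C} {x : ℤ → V} (h : IsAlternating c x) (k : ℤ) :
    IsAlternating c fun i => x (k + i) := by
  intro i
  rw [seqEdge_shift, seqEdge_shift, ← add_assoc]
  exact h _

theorem IsAlternating.reflect {c : Sym2 V → C} {x : ℤ → V} (h : IsAlternating c x) (k : ℤ) :
    IsAlternating c fun i => x (k - i) := by
  intro i
  rw [seqEdge_reflect, seqEdge_reflect, h (k - (i + 2) - 1)]
  congr 2
  ring

theorem IsAlternating.add_two_mul {c : Sym2 V → C} {x : ℤ → V} (h : IsAlternating c x) (i : ℤ)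
    (m : ℕ) : c (seqEdge x (i + 2 * m)) = c (seqEdge x i) := by
  induction m with
  | zero => simp
  | succ m ih =>
    rw [← ih, h (i + 2 * m)]
    congr 2
    push_cast
    ring

theorem IsCyclicSeq.eq_of_forall_lt {n : ℕ} (hn : 0 < n) {x y : ℤ → V} (hx : IsCyclicSeq n x)
    (hy : IsCyclicSeq n y) (h : ∀ m : ℕ, m < n → x m = y m) : x = y := by
  funext i
  have hi : (n : ℤ) ∣ i - i % n := Int.dvd_self_sub_emod
  rw [(hx i (i % n)).2 hi, (hy i (i % n)).2 hi]
  have h₀ : 0 ≤ i % n := Int.emod_nonneg _ (by omega)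
  have h₁ : i % n < n := Int.emod_lt_of_pos _ (by omega)
  lift i % n to ℕ using h₀ with m
  exact h m (by exact_mod_cast h₁)

theorem IsCyclicSeq.le_card [Fintype V] {n : ℕ} {x : ℤ → V} (hx : IsCyclicSeq n x) :
    n ≤ Fintype.card V := by
  have : Function.Injective fun i : Fin n => x (i : ℕ) := by
    intro i j hij
    have h := Int.eq_zero_of_abs_lt_dvd ((hx _ _).1 hij) (by rw [abs_lt]; omega)
    omega
  simpa using Fintype.card_le_of_injective _ this

end Sequences

section Valid

variable {V C : Type*}

theorem ValidOn.mono {S T : Finset (Sym2 V)} (hST : S ⊆ T) {c : Sym2 V → C}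
    (h : ValidOn T c) : ValidOn S c :=
  ⟨fun a b d hb hd => h.1 a b d (hST hb) (hST hd),
    fun n x hn hx hm => h.2 n x hn hx fun i => hST (hm i)⟩

theorem ValidOn.congr {S : Finset (Sym2 V)} {c c' : Sym2 V → C} (hc : ∀ e ∈ S, c e = c' e)
    (h : ValidOn S c) : ValidOn S c' := by
  refine ⟨fun a b d hb hd => ?_, fun n x hn hx hm hc' => h.2 n x hn hx hm fun i => ?_⟩
  · rw [← hc _ hb, ← hc _ hd]
    exact h.1 a b d hb hd
  · rw [hc _ (hm _), hc _ (hm _)]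
    exact hc' i

theorem ValidOn.update [DecidableEq V] {S : Finset (Sym2 V)} {e : Sym2 V} (he : e ∉ S)
    {c : Sym2 V → C} (h : ValidOn S c) (a : C) : ValidOn S (Function.update c e a) :=
  h.congr fun _ hf => (Function.update_of_ne (ne_of_mem_of_not_mem hf he) _ _).symm

theorem ValidOn.insert_or_exists [DecidableEq V] {S : Finset (Sym2 V)} {u v : V}
    {c : Sym2 V → C} (h : ValidOn S c) (hl : ¬ HasLocalConflict S u v c) :
    ValidOn (insert s(u, v) S) c ∨
      ∃ (j : ℕ) (x : ℤ → V), IsAlternatingThrough S u v (2 * j + 6) c x := by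
  unfold HasLocalConflict at hl
  push Not at hl
  obtain ⟨hu, hv, h₄⟩ := hl
  have key : ∀ a b d, s(a, b) = s(u, v) → s(a, d) ∈ S → c s(a, d) ≠ c s(u, v) := by
    intro a b d hab hd
    rcases Sym2.eq_iff.1 hab with ⟨rfl, rfl⟩ | ⟨rfl, rfl⟩
    · exact hu d hd
    · exact hv d hd
  have proper : ∀ a b d, s(a, b) ∈ insert s(u, v) S → s(a, d) ∈ insert s(u, v) S → b ≠ d →
      c s(a, b) ≠ c s(a, d) := by
    intro a b d hb hd hbd
    rcases Finset.mem_insert.1 hb with hb | hb <;> rcases Finset.mem_insert.1 hd with hd | hd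
    · exact absurd (Sym2.congr_right.1 (hb.trans hd.symm)) hbd
    · rw [hb]
      exact (key a b d hb hd).symm
    · rw [hd]
      exact key a d b hd hb
    · exact h.1 a b d hb hd hbd
  by_cases hc : ∃ (n : ℕ) (x : ℤ → V), 3 ≤ n ∧ IsCyclicSeq n x ∧
      (∀ i, seqEdge x i ∈ insert s(u, v) S) ∧ IsAlternating c x
  swap
  · push Not at hc
    exact Or.inl ⟨proper, hc⟩
  right
  obtain ⟨n, x, hn, hx, hm, ha⟩ := hc
  obtain ⟨i, hi⟩ : ∃ i, seqEdge x i = s(u, v) := by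
    by_contra! hne
    exact h.2 n x hn hx (fun i => Finset.mem_of_mem_insert_of_ne (hm i) (hne i)) ha
  obtain ⟨y, hy⟩ : ∃ y, IsAlternatingThrough S u v n c y := by
    rcases Sym2.eq_iff.1 hi with ⟨h₁, h₂⟩ | ⟨h₁, h₂⟩
    · refine ⟨_, hx.shift i, by simpa using h₁, h₂, fun j => ?_, ha.shift i⟩
      rw [seqEdge_shift]
      exact Finset.mem_insert.1 (hm _)
    · refine ⟨_, hx.reflect (i + 1), by simpa using h₂, by simpa using h₁, fun j => ?_,
        ha.reflect (i + 1)⟩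
      rw [seqEdge_reflect]
      exact Finset.mem_insert.1 (hm _)
  have hmem : ∀ i, seqEdge y i ∈ insert s(u, v) S := fun i => Finset.mem_insert.2 (hy.mem i)
  have consecutive : ∀ i, c (seqEdge y i) ≠ c (seqEdge y (i - 1)) := by
    intro i
    have h₁ := hmem i
    have hswap : seqEdge y (i - 1) = s(y i, y (i - 1)) := by
      rw [seqEdge, sub_add_cancel, Sym2.eq_swap]
    have h₂ := hmem (i - 1)
    have hne : y (i + 1) ≠ y (i - 1) := by
      rw [Ne, hy.cyclic]
      intro hd
      have := Int.le_of_dvd (by omega) hd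
      omega
    rw [hswap] at h₂ ⊢
    exact proper _ _ _ h₁ h₂ hne
  have heven : Even n := by
    by_contra hodd
    obtain ⟨m, rfl⟩ := Nat.not_even_iff_odd.1 hodd
    apply consecutive 0
    rw [← hy.alternating.add_two_mul 0 m]
    congr 1
    rw [hy.cyclic.seqEdge_eq_iff hn]
    simp
  have hne4 : n ≠ 4 := by
    rintro rfl
    have hS : ∀ i : ℤ, ¬ (4 : ℤ) ∣ i → seqEdge y i ∈ S := by
      intro i hi
      refine (hy.mem i).resolve_left fun he => hi ?_
      have h0 : seqEdge y 0 = s(u, v) := by simp [seqEdge, hy.zero, hy.one]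
      simpa using (hy.cyclic.seqEdge_eq_iff hn i 0).1 (he.trans h0.symm)
    have h40 : y 4 = u := by
      rw [← hy.zero, hy.cyclic]
      norm_num
    have e1 := hS 1 (by norm_num)
    have e2 := hS 2 (by norm_num)
    have e3 := hS 3 (by norm_num)
    have a0 := hy.alternating 0
    have a1 := hy.alternating 1
    norm_num [seqEdge, h40, hy.zero, hy.one] at e1 e2 e3 a0 a1
    rw [Sym2.eq_swap (a := y 3) (b := u)] at e3 a1
    exact h₄ _ _ e1 e3 e2 a1 a0.symm
  obtain ⟨m, rfl⟩ := heven
  obtain ⟨j, rfl⟩ : ∃ j, m = j + 3 := ⟨m - 3, by omega⟩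
  refine ⟨j, y, ?_⟩
  convert hy using 1
  ring

end Valid

section Counting

variable {V : Type*} [Fintype V] [DecidableEq V]

theorem mem_validColorings {K : ℕ} {S : Finset (Sym2 V)} {c : Sym2 V → Fin K} :
    c ∈ validColorings K S ↔ ValidOn S c := by
  simp [validColorings]

open Classical in
/-- At most `2d` colors are forbidden for `uv`: a color occurring at both `u` and `v` forbids
at most one further color through a 4-cycle. -/
theorem card_forbidden_le {K d : ℕ} {S : Finset (Sym2 V)} {u v : V} (huv : s(u, v) ∉ S)
    (hu : (Finset.univ.filter fun y => s(u, y) ∈ S).card ≤ d)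
    (hv : (Finset.univ.filter fun x => s(v, x) ∈ S).card ≤ d)
    {c : Sym2 V → Fin K} (hc : ValidOn S c) :
    (Finset.univ.filter fun a => HasLocalConflict S u v (Function.update c s(u, v) a)).card
      ≤ 2 * d := by
  set N := fun w : V => Finset.univ.filter fun y => s(w, y) ∈ S with hN
  set A := fun w : V => (N w).image fun y => c s(w, y) with hA
  set P := (N v ×ˢ N u).filter fun q => c s(v, q.1) = c s(u, q.2) with hP
  have hinj : ∀ w x y, s(w, x) ∈ S → s(w, y) ∈ S → c s(w, x) = c s(w, y) → x = y :=
    fun w x y hx hy h => by_contra fun hxy => hc.1 w x y hx hy hxy h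
  have hPcard : P.card ≤ (A u ∩ A v).card := by
    apply Finset.card_le_card_of_injOn fun q => c s(v, q.1)
    · rintro ⟨x, y⟩ hq
      simp only [hP, hN, Finset.coe_filter, Finset.mem_product, Finset.mem_filter,
        Finset.mem_univ, true_and, Set.mem_ofPred_eq] at hq
      simp only [hA, hN, Finset.coe_inter, Set.mem_inter_iff, Finset.mem_coe, Finset.mem_image,
        Finset.mem_filter, Finset.mem_univ, true_and]
      exact ⟨⟨y, hq.1.2, hq.2.symm⟩, x, hq.1.1, rfl⟩
    · rintro ⟨x, y⟩ hq ⟨x', y'⟩ hq' h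
      simp only [hP, hN, Finset.coe_filter, Finset.mem_product, Finset.mem_filter,
        Finset.mem_univ, true_and, Set.mem_ofPred_eq] at hq hq' h
      rw [hinj v x x' hq.1.1 hq'.1.1 h,
        hinj u y y' hq.1.2 hq'.1.2 (hq.2.symm.trans (h.trans hq'.2))]
  have hsub : (Finset.univ.filter fun a =>
      HasLocalConflict S u v (Function.update c s(u, v) a)) ⊆
        (A u ∪ A v) ∪ P.image fun q => c s(q.1, q.2) := by
    intro a ha
    have hup : ∀ f ∈ S, Function.update c s(u, v) a f = c f := fun f hf =>
      Function.update_of_ne (ne_of_mem_of_not_mem hf huv) _ _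
    simp only [Finset.mem_filter, Finset.mem_univ, true_and, HasLocalConflict,
      Function.update_self] at ha
    simp only [hA, hN, hP, Finset.mem_union, Finset.mem_image, Finset.mem_filter,
      Finset.mem_univ, true_and, Finset.mem_product]
    rcases ha with ⟨y, hy, h⟩ | ⟨x, hx, h⟩ | ⟨x, y, hx, hy, hxy, h, h'⟩
    · exact Or.inl (Or.inl ⟨y, hy, by rw [← h, hup _ hy]⟩)
    · exact Or.inl (Or.inr ⟨x, hx, by rw [← h, hup _ hx]⟩)
    · rw [hup _ hx, hup _ hy] at h
      exact Or.inr ⟨(x, y), ⟨⟨hx, hy⟩, h⟩, by rw [← h', hup _ hxy]⟩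
  have h₁ := (Finset.card_le_card hsub).trans (Finset.card_union_le _ _)
  have h₂ : (P.image fun q => c s(q.1, q.2)).card ≤ P.card := Finset.card_image_le
  have h₃ := Finset.card_union_add_card_inter (A u) (A v)
  have h₄ : (A u).card ≤ d := Finset.card_image_le.trans hu
  have h₅ : (A v).card ≤ d := Finset.card_image_le.trans hv
  omega

open Classical in
/-- With `4d` colors, at most half of the colorings valid on `S` have a local conflict. -/
theorem two_mul_card_conflict_le {d : ℕ} (hd : 0 < d) {S : Finset (Sym2 V)} {u v : V}
    (huv : s(u, v) ∉ S)
    (hu : (Finset.univ.filter fun y => s(u, y) ∈ S).card ≤ d)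
    (hv : (Finset.univ.filter fun x => s(v, x) ∈ S).card ≤ d) :
    2 * ((validColorings (4 * d) S).filter (HasLocalConflict S u v)).card ≤
      (validColorings (4 * d) S).card := by
  set W := validColorings (4 * d) S with hW
  set D := W.filter (HasLocalConflict S u v) with hD
  have hle : (D ×ˢ (Finset.univ : Finset (Fin (4 * d)))).card ≤
      (W.sigma fun c => Finset.univ.filter fun a =>
        HasLocalConflict S u v (Function.update c s(u, v) a)).card := by
    apply Finset.card_le_card_of_injOn
      fun q => ⟨Function.update q.1 s(u, v) q.2, q.1 s(u, v)⟩
    · rintro ⟨c, a⟩ hq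
      simp only [hD, Finset.coe_product, Set.mem_prod, Finset.mem_coe, Finset.mem_filter] at hq
      simp only [Finset.mem_coe, Finset.mem_sigma, Finset.mem_filter, Finset.mem_univ, true_and,
        Function.update_idem, Function.update_eq_self]
      rw [hW, mem_validColorings] at hq ⊢
      exact ⟨hq.1.1.update huv a, hq.1.2⟩
    · rintro ⟨c, a⟩ - ⟨c', a'⟩ - h
      simp only [Sigma.mk.injEq, heq_eq_eq] at h
      have ha : a = a' := by simpa using congrFun h.1 s(u, v)
      have hc := congrArg (fun g => Function.update g s(u, v) (c s(u, v))) h.1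
      simp only [Function.update_idem, Function.update_eq_self] at hc
      rw [h.2, Function.update_eq_self] at hc
      rw [hc, ha]
  rw [Finset.card_product, Finset.card_sigma, Finset.card_univ, Fintype.card_fin] at hle
  have hsum : ∑ c ∈ W, (Finset.univ.filter fun a =>
      HasLocalConflict S u v (Function.update c s(u, v) a)).card ≤ W.card * (2 * d) := by
    refine (Finset.sum_le_card_nsmul W _ (2 * d) fun c hc => ?_).trans_eq (smul_eq_mul _ _)
    exact card_forbidden_le huv hu hv (mem_validColorings.1 hc)
  have := hle.trans hsum
  nlinarith

open Classical in
/-- If `c` is valid on `S` and alternates along a given cycle through `uv`, then it is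
determined by its restriction to the complement of `n - 2` consecutive edges of the cycle. -/
theorem card_alternating_mul_pow_le {K m : ℕ} {S : Finset (Sym2 V)} {x : ℤ → V}
    (hm : 1 ≤ m) (hx : IsCyclicSeq (m + 2) x) :
    ((validColorings K S).filter fun c => IsAlternating c x).card * K ^ m ≤
      (validColorings K (S \ (Finset.range m).image fun i : ℕ => seqEdge x i)).card := by
  set R := (Finset.range m).image fun i : ℕ => seqEdge x i with hR
  have hRcard : R.card = m := by
    rw [hR, Finset.card_image_of_injOn, Finset.card_range]
    intro i hi j hj hij
    have hi := Finset.mem_range.1 hi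
    have hj := Finset.mem_range.1 hj
    have h := (hx.seqEdge_eq_iff (by omega) _ _).1 hij
    have h := Int.eq_zero_of_abs_lt_dvd h (by rw [abs_lt]; push_cast; omega)
    omega
  have hout : ∀ k : ℕ, m ≤ k → k < m + 2 → seqEdge x k ∉ R := by
    intro k hk hk' hmem
    obtain ⟨i, hi, hik⟩ := Finset.mem_image.1 hmem
    have hi := Finset.mem_range.1 hi
    have h := (hx.seqEdge_eq_iff (by omega) _ _).1 hik
    have h := Int.eq_zero_of_abs_lt_dvd h (by rw [abs_lt]; push_cast; omega)
    omega
  set glue : (Sym2 V → Fin K) × (R → Fin K) → Sym2 V → Fin K :=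
    fun q e => if h : e ∈ R then q.2 ⟨e, h⟩ else q.1 e with hglue
  have hle : (((validColorings K S).filter fun c => IsAlternating c x) ×ˢ
      (Finset.univ : Finset (R → Fin K))).card ≤ (validColorings K (S \ R)).card := by
    apply Finset.card_le_card_of_injOn glue
    · rintro ⟨c, g⟩ hq
      simp only [Finset.coe_product, Set.mem_prod, Finset.mem_coe, Finset.mem_filter,
        mem_validColorings] at hq ⊢
      refine (hq.1.1.mono Finset.sdiff_subset).congr fun e he => ?_
      simp [hglue, (Finset.mem_sdiff.1 he).2]
    · rintro ⟨c, g⟩ hq ⟨c', g'⟩ hq' h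
      simp only [Finset.coe_product, Set.mem_prod, Finset.mem_coe, Finset.mem_filter] at hq hq'
      have hoff : ∀ e ∉ R, c e = c' e := by
        intro e he
        simpa [hglue, he] using congrFun h e
      have hg : g = g' := by
        funext ⟨e, he⟩
        simpa [hglue, he] using congrFun h e
      have hdesc : ∀ t k : ℕ, k + t = m + 1 → c (seqEdge x k) = c' (seqEdge x k) := by
        intro t
        induction t using Nat.strong_induction_on with
        | _ t ih =>
          intro k hk
          by_cases ht : t < 2
          · exact hoff _ (hout k (by omega) (by omega))
          · rw [hq.1.2 k, hq'.1.2 k]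
            exact_mod_cast ih (t - 2) (by omega) (k + 2) (by omega)
      have hc : c = c' := by
        funext e
        by_cases he : e ∈ R
        · obtain ⟨i, hi, rfl⟩ := Finset.mem_image.1 he
          have hi := Finset.mem_range.1 hi
          exact hdesc (m + 1 - i) i (by omega)
        · exact hoff e he
      rw [hc, hg]
  rwa [Finset.card_product, Finset.card_univ, Fintype.card_fun, Fintype.card_fin,
    Fintype.card_coe, hRcard] at hle

end Counting

section Extension

variable {V : Type*} [Fintype V] [DecidableEq V]

theorem exists_fin_injOn {α : Type*} {d : ℕ} (hd : 0 < d) (s : Finset α) (hs : s.card ≤ d) :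
    ∃ g : α → Fin d, Set.InjOn g s := by
  classical
  refine ⟨fun a => if h : a ∈ s then Fin.castLE hs (s.equivFin ⟨a, h⟩) else ⟨0, hd⟩, ?_⟩
  intro a ha b hb hab
  have ha : a ∈ s := ha
  have hb : b ∈ s := hb
  simpa [ha, hb] using hab

/-- Cyclic sequences in `G` with prescribed first two vertices can be encoded by choosing each
further vertex among the at most `d` continuations of the path. -/
theorem exists_cyclicSeq_code (G : SimpleGraph V) [DecidableRel G.Adj] {d : ℕ} (hd : 0 < d)
    (hG : ∀ v, G.degree v ≤ d + 1) {m : ℕ} (hm : 1 ≤ m) :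
    ∃ code : (ℤ → V) → Fin m → Fin d, ∀ x y,
      IsCyclicSeq (m + 2) x → IsCyclicSeq (m + 2) y →
      (∀ i, G.Adj (x i) (x (i + 1))) → (∀ i, G.Adj (y i) (y (i + 1))) →
      x 0 = y 0 → x 1 = y 1 → code x = code y → x = y := by
  have hg : ∀ a b, ∃ g : V → Fin d, G.Adj a b → Set.InjOn g ((G.neighborFinset b).erase a) := by
    intro a b
    by_cases hab : G.Adj a b
    · have hcard : ((G.neighborFinset b).erase a).card ≤ d := by
        rw [Finset.card_erase_of_mem (by simpa using hab.symm), G.card_neighborFinset_eq_degree]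
        have := hG b
        omega
      obtain ⟨g, hg⟩ := exists_fin_injOn hd _ hcard
      exact ⟨g, fun _ => hg⟩
    · exact ⟨fun _ => ⟨0, hd⟩, fun h => absurd h hab⟩
  choose g hg using hg
  refine ⟨fun x i => g (x (i : ℕ)) (x ((i : ℕ) + 1)) (x ((i : ℕ) + 2)), ?_⟩
  intro x y hx hy hxG hyG h₀ h₁ hcode
  have key : ∀ k : ℕ, k < m + 1 → x k = y k ∧ x (k + 1) = y (k + 1) := by
    intro k
    induction k with
    | zero => exact fun _ => ⟨by simpa using h₀, by simpa using h₁⟩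
    | succ k ih =>
      intro hk
      obtain ⟨ih₀, ih₁⟩ := ih (by omega)
      have hmem : ∀ z : ℤ → V, IsCyclicSeq (m + 2) z → (∀ i, G.Adj (z i) (z (i + 1))) →
          z (k + 2) ∈ (G.neighborFinset (z (k + 1))).erase (z k) := by
        intro z hz hzG
        rw [Finset.mem_erase, SimpleGraph.mem_neighborFinset, Ne, hz]
        refine ⟨fun hdvd => ?_, ?_⟩
        · have := Int.le_of_dvd (by omega) hdvd
          push_cast at this
          omega
        · have := hzG (k + 1)
          rwa [add_assoc] at this
      have hyz := hmem y hy hyG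
      rw [← ih₀, ← ih₁] at hyz
      have hc := congrFun hcode ⟨k, by omega⟩
      simp only [← ih₀, ← ih₁] at hc
      have := hg _ _ (hxG k) (hmem x hx hxG) hyz hc
      push_cast
      exact ⟨ih₁, by rwa [add_assoc]⟩
  refine hx.eq_of_forall_lt (by omega) hy fun k hk => ?_
  rcases Nat.lt_succ_iff_lt_or_eq.1 hk with hk | rfl
  · exact (key k hk).1
  · exact_mod_cast (key m (by omega)).2

open Classical in
theorem card_exists_alternating_le (G : SimpleGraph V) [DecidableRel G.Adj] {d K m : ℕ}
    (hd : 0 < d) (hG : ∀ v, G.degree v ≤ d + 1) (hm : 1 ≤ m) {q : ℝ} (hq₀ : 0 ≤ q) (hq₁ : q ≤ 1)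
    {S : Finset (Sym2 V)} (hS : S ⊆ G.edgeFinset) {u v : V} (huvG : s(u, v) ∈ G.edgeFinset)
    (huv : s(u, v) ∉ S)
    (hind : ∀ A ⊆ S, q ^ (S \ A).card * (validColorings K A).card ≤ (validColorings K S).card) :
    (((validColorings K S).filter fun c =>
      ∃ x, IsAlternatingThrough S u v (m + 2) c x).card : ℝ) * (K ^ m * q ^ (m - 1)) ≤
      d ^ m * (validColorings K S).card := by
  obtain ⟨code, hcode⟩ := exists_cyclicSeq_code G hd hG hm
  have hadj : ∀ c : Sym2 V → Fin K, ∀ x, IsAlternatingThrough S u v (m + 2) c x →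
      ∀ i, G.Adj (x i) (x (i + 1)) := by
    intro c x hx i
    rw [← SimpleGraph.mem_edgeSet, ← SimpleGraph.mem_edgeFinset]
    rcases hx.mem i with h | h
    · exact (show s(x i, x (i + 1)) = s(u, v) from h) ▸ huvG
    · exact hS h
  set B : (Fin m → Fin d) → Finset (Sym2 V → Fin K) := fun t =>
    (validColorings K S).filter fun c =>
      ∃ x, IsAlternatingThrough S u v (m + 2) c x ∧ code x = t
  have hBt : ∀ t, ((B t).card : ℝ) * (K ^ m * q ^ (m - 1)) ≤ (validColorings K S).card := by
    intro t
    rcases (B t).eq_empty_or_nonempty with h | ⟨c₀, hc₀⟩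
    · simp [h]
    obtain ⟨x, hx, hxt⟩ := (Finset.mem_filter.1 hc₀).2
    have hsub : B t ⊆ (validColorings K S).filter fun c => IsAlternating c x := by
      intro c hc
      obtain ⟨hcS, y, hy, hyt⟩ := Finset.mem_filter.1 hc
      have hxy : x = y := hcode x y hx.cyclic hy.cyclic (hadj _ _ hx) (hadj _ _ hy)
        (hx.zero.trans hy.zero.symm) (hx.one.trans hy.one.symm) (hxt.trans hyt.symm)
      exact Finset.mem_filter.2 ⟨hcS, hxy ▸ hy.alternating⟩
    have h₁ := (Nat.mul_le_mul_right (K ^ m) (Finset.card_le_card hsub)).trans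
      (card_alternating_mul_pow_le hm hx.cyclic)
    set R := (Finset.range m).image fun i : ℕ => seqEdge x i
    have hcard : (S \ (S \ R)).card ≤ m - 1 := by
      have hmemR : s(u, v) ∈ R :=
        Finset.mem_image.2 ⟨0, Finset.mem_range.2 hm, by simp [seqEdge, hx.zero, hx.one]⟩
      have hsubR : S \ (S \ R) ⊆ R.erase s(u, v) := by
        intro e he
        rw [sdiff_sdiff_right_self] at he
        obtain ⟨heS, heR⟩ := Finset.mem_inter.1 he
        exact Finset.mem_erase.2 ⟨ne_of_mem_of_not_mem heS huv, heR⟩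
      have hRm : R.card ≤ m := Finset.card_image_le.trans (Finset.card_range m).le
      have := Finset.card_le_card hsubR
      rw [Finset.card_erase_of_mem hmemR] at this
      omega
    calc ((B t).card : ℝ) * (K ^ m * q ^ (m - 1))
        = q ^ (m - 1) * ((B t).card * K ^ m) := by ring
      _ ≤ q ^ (S \ (S \ R)).card * (validColorings K (S \ R)).card := by
          gcongr ?_ * ?_
          · exact pow_le_pow_of_le_one hq₀ hq₁ hcard
          · exact_mod_cast h₁
      _ ≤ (validColorings K S).card := hind _ Finset.sdiff_subset
  have hunion : ((validColorings K S).filter fun c =>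
      ∃ x, IsAlternatingThrough S u v (m + 2) c x) ⊆ Finset.univ.biUnion B := by
    intro c hc
    obtain ⟨hcS, x, hx⟩ := Finset.mem_filter.1 hc
    exact Finset.mem_biUnion.2
      ⟨code x, Finset.mem_univ _, Finset.mem_filter.2 ⟨hcS, x, hx, rfl⟩⟩
  have hsum : (((validColorings K S).filter fun c =>
      ∃ x, IsAlternatingThrough S u v (m + 2) c x).card : ℝ) ≤ ∑ t, ((B t).card : ℝ) := by
    exact_mod_cast (Finset.card_le_card hunion).trans Finset.card_biUnion_le
  calc _ ≤ (∑ t, ((B t).card : ℝ)) * (K ^ m * q ^ (m - 1)) := by gcongr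
    _ = ∑ t, ((B t).card : ℝ) * (K ^ m * q ^ (m - 1)) := Finset.sum_mul _ _ _
    _ ≤ ∑ _t : Fin m → Fin d, ((validColorings K S).card : ℝ) :=
        Finset.sum_le_sum fun t _ => hBt t
    _ = d ^ m * (validColorings K S).card := by simp

open Real in
theorem inv_goldenRatio_eq_sub_one : goldenRatio⁻¹ = goldenRatio - 1 := by
  linarith [inv_goldenRatio, one_sub_goldenRatio]

open Real in
theorem sum_inv_goldenRatio_pow_le (M : ℕ) :
    ∑ j ∈ Finset.range M, (goldenRatio⁻¹) ^ (2 * j + 4) ≤ (goldenRatio⁻¹) ^ 3 := by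
  have hsq : goldenRatio⁻¹ ^ 2 = 1 - goldenRatio⁻¹ := by
    rw [inv_goldenRatio_eq_sub_one]
    linear_combination goldenRatio_sq
  have h : ∑ j ∈ Finset.range M, (goldenRatio⁻¹) ^ (2 * j + 4) =
      (goldenRatio⁻¹) ^ 3 - (goldenRatio⁻¹) ^ (2 * M + 3) := by
    induction M with
    | zero => simp
    | succ M ih =>
      rw [Finset.sum_range_succ, ih]
      have : (goldenRatio⁻¹) ^ (2 * (M + 1) + 3) =
          (goldenRatio⁻¹) ^ (2 * M + 3) * (goldenRatio⁻¹) ^ 2 := by ring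
      rw [this, hsq]
      ring
  rw [h]
  have : 0 ≤ (goldenRatio⁻¹) ^ (2 * M + 3) := pow_nonneg (inv_nonneg.2 goldenRatio_pos.le) _
  linarith

open Classical Real in
/-- Adding an edge keeps at least a `φ / 4` proportion of the valid colorings. -/
theorem card_validColorings_insert_ge (G : SimpleGraph V) [DecidableRel G.Adj] {d : ℕ}
    (hd : 0 < d) (hG : ∀ v, G.degree v ≤ d + 1)
    {S : Finset (Sym2 V)} (hS : S ⊆ G.edgeFinset) {e : Sym2 V} (heG : e ∈ G.edgeFinset)
    (he : e ∉ S)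
    (hind : ∀ A ⊆ S, (goldenRatio / 4) ^ (S \ A).card * (validColorings (4 * d) A).card ≤
      (validColorings (4 * d) S).card) :
    goldenRatio / 4 * (validColorings (4 * d) S).card ≤
      (validColorings (4 * d) (insert e S)).card := by
  induction e using Sym2.ind with
  | _ u v =>
  set W := validColorings (4 * d) S
  set B : ℕ → Finset (Sym2 V → Fin (4 * d)) := fun j =>
    W.filter fun c => ∃ x, IsAlternatingThrough S u v (2 * j + 4 + 2) c x
  set D := W.filter (HasLocalConflict S u v)
  have hdeg : ∀ a b, s(a, b) ∈ G.edgeFinset → s(a, b) ∉ S →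
      (Finset.univ.filter fun y => s(a, y) ∈ S).card ≤ d := by
    intro a b habG hab
    have hsub : (Finset.univ.filter fun y => s(a, y) ∈ S) ⊆ (G.neighborFinset a).erase b := by
      intro y hy
      have hy : s(a, y) ∈ S := by simpa using hy
      refine Finset.mem_erase.2 ⟨?_, by simpa using hS hy⟩
      rintro rfl
      exact hab hy
    have h := Finset.card_le_card hsub
    rw [Finset.card_erase_of_mem (by simpa using habG),
      G.card_neighborFinset_eq_degree] at h
    have := hG a
    omega
  have hDcard : 2 * D.card ≤ W.card := by
    apply two_mul_card_conflict_le hd he (hdeg u v heG he)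
    rw [Sym2.eq_swap] at heG he
    exact hdeg v u heG he
  have hBcard : ∀ j, ((B j).card : ℝ) ≤
      W.card * (goldenRatio / 4) * goldenRatio⁻¹ ^ (2 * j + 4) := by
    intro j
    have hφ := goldenRatio_pos
    have h := card_exists_alternating_le G hd hG (m := 2 * j + 4) (by omega) (by positivity)
      (by linarith [goldenRatio_lt_two]) hS heG he hind
    have hd' : (0 : ℝ) < d := by exact_mod_cast hd
    rw [inv_pow, ← div_eq_mul_inv, le_div_iff₀ (by positivity)]
    have h4 : ((4 * d : ℕ) : ℝ) ^ (2 * j + 4) * (goldenRatio / 4) ^ (2 * j + 4 - 1) *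
        (goldenRatio / 4) = d ^ (2 * j + 4) * goldenRatio ^ (2 * j + 4) := by
      rw [mul_assoc, ← pow_succ, show 2 * j + 4 - 1 + 1 = 2 * j + 4 by omega, ← mul_pow,
        ← mul_pow]
      congr 1
      push_cast
      ring
    refine le_of_mul_le_mul_left ?_ (pow_pos hd' (2 * j + 4))
    calc (d : ℝ) ^ (2 * j + 4) * ((B j).card * goldenRatio ^ (2 * j + 4))
        = (B j).card * (((4 * d : ℕ) : ℝ) ^ (2 * j + 4) *
            (goldenRatio / 4) ^ (2 * j + 4 - 1)) * (goldenRatio / 4) := by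
          rw [mul_assoc, h4]
          ring
      _ ≤ d ^ (2 * j + 4) * W.card * (goldenRatio / 4) := by gcongr
      _ = _ := by ring
  have hcover : W ⊆ validColorings (4 * d) (insert s(u, v) S) ∪
      (D ∪ (Finset.range (Fintype.card V)).biUnion B) := by
    intro c hc
    simp only [Finset.mem_union, Finset.mem_biUnion, Finset.mem_range]
    by_cases hl : HasLocalConflict S u v c
    · exact Or.inr (Or.inl (Finset.mem_filter.2 ⟨hc, hl⟩))
    rcases (mem_validColorings.1 hc).insert_or_exists hl with h | ⟨j, x, hx⟩
    · exact Or.inl (mem_validColorings.2 h)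
    · have := hx.cyclic.le_card
      exact Or.inr (Or.inr ⟨j, by omega, Finset.mem_filter.2 ⟨hc, x, hx⟩⟩)
  have hcard : W.card ≤ (validColorings (4 * d) (insert s(u, v) S)).card +
      (D.card + ∑ j ∈ Finset.range (Fintype.card V), (B j).card) :=
    (Finset.card_le_card hcover).trans <| (Finset.card_union_le _ _).trans <|
      Nat.add_le_add_left ((Finset.card_union_le _ _).trans <|
        Nat.add_le_add_left Finset.card_biUnion_le _) _
  have hsum : ∑ j ∈ Finset.range (Fintype.card V), ((B j).card : ℝ) ≤
      W.card * (goldenRatio / 4) * goldenRatio⁻¹ ^ 3 := by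
    refine (Finset.sum_le_sum fun j _ => hBcard j).trans ?_
    rw [← Finset.mul_sum]
    have := goldenRatio_pos
    gcongr
    exact sum_inv_goldenRatio_pow_le _
  have hφ : goldenRatio / 4 * goldenRatio⁻¹ ^ 3 = 1 / 2 - goldenRatio / 4 := by
    rw [inv_goldenRatio_eq_sub_one]
    linear_combination (goldenRatio ^ 2 - 2 * goldenRatio + 2) / 4 * goldenRatio_sq
  rw [mul_assoc, hφ] at hsum
  have h₁ : (W.card : ℝ) ≤ (validColorings (4 * d) (insert s(u, v) S)).card +
      (D.card + ∑ j ∈ Finset.range (Fintype.card V), ((B j).card : ℝ)) := by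
    exact_mod_cast hcard
  have h₂ : 2 * (D.card : ℝ) ≤ W.card := by exact_mod_cast hDcard
  linarith

open Real in
theorem pow_mul_card_validColorings_le (G : SimpleGraph V) [DecidableRel G.Adj] {d : ℕ}
    (hd : 0 < d) (hG : ∀ v, G.degree v ≤ d + 1) (S : Finset (Sym2 V)) (hS : S ⊆ G.edgeFinset) :
    ∀ A ⊆ S, (goldenRatio / 4) ^ (S \ A).card * (validColorings (4 * d) A).card ≤
      (validColorings (4 * d) S).card := by
  induction S using Finset.strongInduction with
  | H S ih =>
  intro A hA
  rcases hA.eq_or_ssubset with rfl | hlt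
  · simp
  obtain ⟨e, heS, heA⟩ := Finset.exists_of_ssubset hlt
  have hsub := (Finset.erase_subset e S).trans hS
  have hT := ih _ (Finset.erase_ssubset heS) hsub
  have hstep := card_validColorings_insert_ge G hd hG hsub (hS heS) (Finset.notMem_erase e S) hT
  rw [Finset.insert_erase heS] at hstep
  have hAT : A ⊆ S.erase e := fun f hf => Finset.mem_erase.2 ⟨ne_of_mem_of_not_mem hf heA, hA hf⟩
  have hcard : (S \ A).card = (S.erase e \ A).card + 1 := by
    rw [Finset.erase_sdiff_comm, Finset.card_erase_add_one (Finset.mem_sdiff.2 ⟨heS, heA⟩)]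
  rw [hcard, pow_succ', mul_assoc]
  refine le_trans ?_ hstep
  have := goldenRatio_pos
  gcongr
  exact hT A hAT

theorem exists_validOn_edgeFinset (G : SimpleGraph V) [DecidableRel G.Adj] {d : ℕ}
    (hd : 0 < d) (hG : ∀ v, G.degree v ≤ d + 1) :
    ∃ c : Sym2 V → Fin (4 * d), ValidOn G.edgeFinset c := by
  have h := pow_mul_card_validColorings_le G hd hG G.edgeFinset subset_rfl ∅
    (Finset.empty_subset _)
  have h₀ : 0 < (validColorings (4 * d) (∅ : Finset (Sym2 V))).card := by
    refine Finset.card_pos.2 ⟨fun _ => ⟨0, by omega⟩, mem_validColorings.2 ⟨?_, ?_⟩⟩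
    · simp
    · exact fun n x _ _ hx => absurd (hx 0) (Finset.notMem_empty _)
  have hpos : (0 : ℝ) < (validColorings (4 * d) G.edgeFinset).card := by
    refine lt_of_lt_of_le ?_ h
    have := Real.goldenRatio_pos
    positivity
  obtain ⟨c, hc⟩ := Finset.card_pos.1 (by exact_mod_cast hpos)
  exact ⟨c, mem_validColorings.1 hc⟩

end Extension

theorem ValidOn.isProperEdgeColoring {V C : Type*} {G : SimpleGraph V} [Fintype G.edgeSet]
    {c : Sym2 V → C} (h : ValidOn G.edgeFinset c) : IsProperEdgeColoring G c := by
  rintro e₁ h₁ e₂ h₂ hne ⟨a, ha₁, ha₂⟩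
  obtain ⟨b, rfl⟩ := Sym2.mem_iff_exists.1 ha₁
  obtain ⟨d, rfl⟩ := Sym2.mem_iff_exists.1 ha₂
  exact h.1 a b d (by simpa using h₁) (by simpa using h₂) fun hbd => hne (by rw [hbd])

theorem ValidOn.isAcyclicEdgeColoring {V C : Type*} [DecidableEq C] {G : SimpleGraph V}
    [Fintype G.edgeSet] {c : Sym2 V → C} (h : ValidOn G.edgeFinset c) :
    IsAcyclicEdgeColoring G c := by
  refine ⟨h.isProperEdgeColoring, fun u p hp => ?_⟩
  by_contra! hcard
  set n := p.length with hn
  have hn3 : 3 ≤ n := hp.three_le_length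
  set x : ℤ → V := fun i => p.getVert (i % n).toNat with hx
  have hcyc : IsCyclicSeq n x := by
    intro i j
    have hi₀ := Int.emod_nonneg i (b := n) (by omega)
    have hi₁ := Int.emod_lt_of_pos i (b := n) (by omega)
    have hj₀ := Int.emod_nonneg j (b := n) (by omega)
    have hj₁ := Int.emod_lt_of_pos j (b := n) (by omega)
    rw [Int.dvd_iff_emod_eq_zero, ← Int.emod_eq_emod_iff_emod_sub_eq_zero]
    refine ⟨fun h => ?_, fun h => by simp only [hx, h]⟩
    have := hp.getVert_injOn' (by rw [Set.mem_ofPred_eq]; omega)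
      (by rw [Set.mem_ofPred_eq]; omega) h
    omega
  have hnext : ∀ i, ∃ k < n, x i = p.getVert k ∧ x (i + 1) = p.getVert (k + 1) := by
    intro i
    have hi₀ := Int.emod_nonneg i (b := n) (by omega)
    have hi₁ := Int.emod_lt_of_pos i (b := n) (by omega)
    refine ⟨(i % n).toNat, by omega, rfl, ?_⟩
    have hmod : (i + 1) % n = (i % n + 1) % n := (Int.emod_add_emod i n 1).symm
    simp only [hx, hmod]
    rcases eq_or_ne (i % n + 1) n with h | h
    · rw [h, Int.emod_self, show (i % n).toNat + 1 = n by omega, hn, p.getVert_length]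
      exact p.getVert_zero
    · rw [Int.emod_eq_of_lt (by omega) (by omega)]
      congr 1
      omega
  have hmem : ∀ i, seqEdge x i ∈ p.edges := by
    intro i
    obtain ⟨k, hk, h₁, h₂⟩ := hnext i
    rw [seqEdge, h₁, h₂]
    exact (p.mk_mem_edges_iff_exists).2 ⟨k, hk, rfl⟩
  have hG : ∀ i, seqEdge x i ∈ G.edgeFinset := fun i => by
    simpa using p.edges_subset_edgeSet (hmem i)
  have hconsec : ∀ i, c (seqEdge x i) ≠ c (seqEdge x (i + 1)) := by
    intro i
    have h₁ := hG i
    have h₂ := hG (i + 1)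
    have hne : x i ≠ x (i + 1 + 1) := by
      rw [Ne, hcyc]
      intro hd
      have := Int.le_of_dvd (by norm_num) ((dvd_neg (a := (n : ℤ))).2 hd)
      omega
    rw [seqEdge, Sym2.eq_swap] at h₁ ⊢
    exact h.1 _ _ _ h₁ h₂ hne
  refine h.2 n x hn3 hcyc hG fun i => ?_
  by_contra hne
  have hsub : ({c (seqEdge x i), c (seqEdge x (i + 1)), c (seqEdge x (i + 2))} : Finset C) ⊆
      (p.edges.map c).toFinset := by
    intro a ha
    simp only [Finset.mem_insert, Finset.mem_singleton] at ha
    rw [List.mem_toFinset, List.mem_map]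
    rcases ha with rfl | rfl | rfl <;> exact ⟨_, hmem _, rfl⟩
  have h₃ := Finset.card_le_card hsub
  have h₁₂ := hconsec (i + 1)
  rw [add_assoc] at h₁₂
  rw [Finset.card_eq_three.2 ⟨_, _, _, hconsec i, hne, h₁₂, rfl⟩] at h₃
  omega

/-- For every finite simple graph `G` with maximum degree `Δ ≥ 2`, the acyclic chromatic
index satisfies `a′(G) ≤ 4(Δ − 1)`, i.e. `G` has an acyclic edge coloring with
`4(Δ − 1)` colors. -/
theorem stmt_8 {V : Type*} [Fintype V] [DecidableEq V] (G : SimpleGraph V)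
    [DecidableRel G.Adj] (hΔ : 2 ≤ G.maxDegree) :
    ∃ c : Sym2 V → Fin (4 * (G.maxDegree - 1)), IsAcyclicEdgeColoring G c := by
  obtain ⟨c, hc⟩ := exists_validOn_edgeFinset G (d := G.maxDegree - 1) (by omega) fun v => by
    have := G.degree_le_maxDegree v
    omega
  exact ⟨c, hc.isAcyclicEdgeColoring⟩
end

section
/- Let G = (V,E) be a finite simple graph with maximum degree Δ, let k > 2Δ, and suppose f is a proper partial edge coloring of G with k colors (a proper coloring of some subset of E) and e ∈ E is an edge not colored by f. Then there exist at least k − 2(Δ − 1) colors c such that extending f by assigning color c to e yields a coloring that is still proper and creates no bichromatic 4-cycle passing through e. -/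
/-- A partial edge coloring (a function `Sym2 V → Option C`, `none` meaning "uncolored")
of a graph `G` is proper if any two distinct adjacent colored edges receive different
colors. -/
def IsProperPartialEdgeColoring {V C : Type*} (G : SimpleGraph V)
    (f : Sym2 V → Option C) : Prop :=
  ∀ e₁ ∈ G.edgeSet, ∀ e₂ ∈ G.edgeSet, e₁ ≠ e₂ → (∃ v, v ∈ e₁ ∧ v ∈ e₂) →
    ∀ c : C, f e₁ = some c → f e₂ ≠ some c

open Classical in
/-- The colors that `f` uses on the edges of `G` at the vertex `u`. -/
noncomputable def colorsAt {V C : Type*} [Fintype C] (G : SimpleGraph V)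
    (f : Sym2 V → Option C) (u : V) : Finset C :=
  Finset.univ.filter fun c => ∃ x, G.Adj u x ∧ f s(u, x) = some c

theorem mem_colorsAt {V C : Type*} [Fintype C] {G : SimpleGraph V}
    {f : Sym2 V → Option C} {u : V} {c : C} :
    c ∈ colorsAt G f u ↔ ∃ x, G.Adj u x ∧ f s(u, x) = some c := by
  simp [colorsAt]

theorem card_colorsAt_le {V C : Type*} [Fintype V] [DecidableEq V] [Fintype C]
    (G : SimpleGraph V) [DecidableRel G.Adj] (f : Sym2 V → Option C) {u v : V}
    (huv : G.Adj u v) (he : f s(u, v) = none) :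
    (colorsAt G f u).card ≤ G.maxDegree - 1 := by
  have hcard : (colorsAt G f u).card ≤ ((G.neighborFinset u).erase v).card := by
    refine Finset.card_le_card_of_forall_subsingleton (fun c x => f s(u, x) = some c) ?_ ?_
    · intro c hc
      obtain ⟨x, hx, hfx⟩ := mem_colorsAt.1 hc
      refine ⟨x, ?_, hfx⟩
      simp only [Finset.mem_erase, SimpleGraph.mem_neighborFinset]
      refine ⟨?_, hx⟩
      rintro rfl
      simp [he] at hfx
    · rintro x - c ⟨-, hc⟩ d ⟨-, hd⟩
      exact Option.some_injective _ (hc.symm.trans hd)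
  rw [Finset.card_erase_of_mem (by simpa using huv), G.card_neighborFinset_eq_degree] at hcard
  exact hcard.trans (Nat.sub_le_sub_right (G.degree_le_maxDegree u) 1)

/-- Two edges at a vertex with the same color have the same other endpoint. -/
theorem IsProperPartialEdgeColoring.eq_of_color_eq {V C : Type*} {G : SimpleGraph V}
    {f : Sym2 V → Option C} (hf : IsProperPartialEdgeColoring G f) {u x y : V}
    (hx : G.Adj u x) (hy : G.Adj u y) {c : C} (hfx : f s(u, x) = some c)
    (hfy : f s(u, y) = some c) : x = y := by
  by_contra hxy
  refine hf s(u, x) hx s(u, y) hy ?_ ⟨u, by simp, by simp⟩ c hfx hfy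
  rwa [Ne, Sym2.congr_right]

open Classical in
/-- The colors of those edges that join the far ends of two edges of equal color,
one at `u` and one at `v`. -/
noncomputable def cycleColors {V C : Type*} [Fintype C] (G : SimpleGraph V)
    (f : Sym2 V → Option C) (u v : V) : Finset C :=
  Finset.univ.filter fun c => ∃ x y a, G.Adj v x ∧ G.Adj u y ∧
    f s(v, x) = some a ∧ f s(u, y) = some a ∧ f s(x, y) = some c

theorem IsProperPartialEdgeColoring.card_cycleColors_le {V C : Type*} [Fintype C]
    [DecidableEq C] {G : SimpleGraph V} {f : Sym2 V → Option C}
    (hf : IsProperPartialEdgeColoring G f) (u v : V) :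
    (cycleColors G f u v).card ≤ (colorsAt G f u ∩ colorsAt G f v).card := by
  refine Finset.card_le_card_of_forall_subsingleton (fun c a => ∃ x y, G.Adj v x ∧
    G.Adj u y ∧ f s(v, x) = some a ∧ f s(u, y) = some a ∧ f s(x, y) = some c) ?_ ?_
  · intro c hc
    simp only [cycleColors, Finset.mem_filter, Finset.mem_univ, true_and] at hc
    obtain ⟨x, y, a, hx, hy, hfx, hfy, hc⟩ := hc
    exact ⟨a, Finset.mem_inter.2 ⟨mem_colorsAt.2 ⟨y, hy, hfy⟩, mem_colorsAt.2 ⟨x, hx, hfx⟩⟩,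
      x, y, hx, hy, hfx, hfy, hc⟩
  · rintro a - c ⟨-, x, y, hx, hy, hfx, hfy, hc⟩ d ⟨-, x', y', hx', hy', hfx', hfy', hd⟩
    obtain rfl := hf.eq_of_color_eq hx hx' hfx hfx'
    obtain rfl := hf.eq_of_color_eq hy hy' hfy hfy'
    exact Option.some_injective _ (hc.symm.trans hd)

theorem eq_and_eq_of_card_le_two {C : Type*} [DecidableEq C] {c c₁ c₂ c₃ : C}
    (h : ({c, c₁, c₂, c₃} : Finset C).card ≤ 2) (h₁ : c ≠ c₁) (h₃ : c ≠ c₃)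
    (h₁₂ : c₁ ≠ c₂) : c₁ = c₃ ∧ c₂ = c := by
  have key : ({c, c₁} : Finset C) = {c, c₁, c₂, c₃} := by
    refine Finset.eq_of_subset_of_card_le (by intro z; simp; tauto) ?_
    rwa [Finset.card_pair h₁]
  have m₂ : c₂ ∈ ({c, c₁} : Finset C) := by simp [key]
  have m₃ : c₃ ∈ ({c, c₁} : Finset C) := by simp [key]
  simp only [Finset.mem_insert, Finset.mem_singleton] at m₂ m₃
  grind

/-- Let `G` be a finite simple graph with maximum degree `Δ`, let `k > 2Δ`, let `f` be a
proper partial edge coloring of `G` with `k` colors and let `e = s(u,v)` be an uncolored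
edge.  Then there are at least `k − 2(Δ − 1)` colors `c` such that assigning `c` to `e`
keeps the coloring proper and creates no bichromatic 4-cycle through `e`. -/
theorem stmt_9 {V : Type*} [Fintype V] [DecidableEq V] (G : SimpleGraph V)
    [DecidableRel G.Adj] (k : ℕ) (hk : 2 * G.maxDegree < k)
    (f : Sym2 V → Option (Fin k)) (hf : IsProperPartialEdgeColoring G f)
    (u v : V) (huv : G.Adj u v) (he : f s(u, v) = none) :
    k - 2 * (G.maxDegree - 1) ≤
      Set.ncard {c : Fin k |
        -- assigning `c` to `e` keeps the coloring proper:
        (∀ e' ∈ G.edgeSet, e' ≠ s(u, v) → (∃ w, w ∈ e' ∧ w ∈ s(u, v)) →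
          f e' ≠ some c) ∧
        -- and creates no bichromatic 4-cycle `u, v, x, y` through `e`:
        ¬ ∃ x y : V, x ≠ u ∧ x ≠ v ∧ y ≠ u ∧ y ≠ v ∧ x ≠ y ∧
          G.Adj v x ∧ G.Adj x y ∧ G.Adj y u ∧
          ∃ c₁ c₂ c₃ : Fin k, f s(v, x) = some c₁ ∧ f s(x, y) = some c₂ ∧
            f s(y, u) = some c₃ ∧ ({c, c₁, c₂, c₃} : Finset (Fin k)).card ≤ 2} := by
  set good : Set (Fin k) := {c | _}
  set bad : Finset (Fin k) :=
    (colorsAt G f u ∪ colorsAt G f v) ∪ cycleColors G f u v with hbad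
  have hsub : ((badᶜ : Finset (Fin k)) : Set (Fin k)) ⊆ good := by
    intro c hc
    simp only [hbad, Finset.coe_compl, Set.mem_compl_iff, Finset.mem_coe,
      Finset.mem_union, not_or] at hc
    obtain ⟨⟨hcu, hcv⟩, hcc⟩ := hc
    refine ⟨?_, ?_⟩
    · rintro e' he' - ⟨w, hwe, hw⟩ hfe
      obtain ⟨x, rfl⟩ := Sym2.mem_iff_exists.1 hwe
      rcases Sym2.mem_iff.1 hw with rfl | rfl
      · exact hcu (mem_colorsAt.2 ⟨x, he', hfe⟩)
      · exact hcv (mem_colorsAt.2 ⟨x, he', hfe⟩)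
    · rintro ⟨x, y, -, -, -, hyv, -, hvx, hxy, hyu, c₁, c₂, c₃, h₁, h₂, h₃, hcard⟩
      rw [Sym2.eq_swap] at h₃
      have hc₁ : c ≠ c₁ := by
        rintro rfl
        exact hcv (mem_colorsAt.2 ⟨x, hvx, h₁⟩)
      have hc₃ : c ≠ c₃ := by
        rintro rfl
        exact hcu (mem_colorsAt.2 ⟨y, hyu.symm, h₃⟩)
      have hc₁₂ : c₁ ≠ c₂ := by
        rintro rfl
        rw [Sym2.eq_swap] at h₁
        exact hyv (hf.eq_of_color_eq hvx.symm hxy h₁ h₂).symm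
      obtain ⟨rfl, rfl⟩ := eq_and_eq_of_card_le_two hcard hc₁ hc₃ hc₁₂
      exact hcc (by
        simp only [cycleColors, Finset.mem_filter, Finset.mem_univ, true_and]
        exact ⟨x, y, c₁, hvx, hyu.symm, h₁, h₃, h₂⟩)
  have hle := Set.ncard_le_ncard hsub (Set.toFinite _)
  rw [Set.ncard_coe_finset, Finset.card_compl, Fintype.card_fin] at hle
  have hu := card_colorsAt_le G f huv he
  have hv := card_colorsAt_le G f huv.symm (by rwa [Sym2.eq_swap])
  have hcyc := hf.card_cycleColors_le u v
  have hunion := Finset.card_union_add_card_inter (colorsAt G f u) (colorsAt G f v)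
  have hb : bad.card ≤ _ :=
    Finset.card_union_le (colorsAt G f u ∪ colorsAt G f v) (cycleColors G f u v)
  omega
end

section
/- There is a positive constant c and an integer K such that for all k ≥ K, the off-diagonal Ramsey number satisfies R(3,k) ≥ c · (k / log k)². -/
/-- `ramseyProp n ℓ k` : every 2-coloring (blue = `true`, red = `false`) of the edges of
the complete graph on `n` vertices contains a blue clique on `ℓ` vertices or a red clique
on `k` vertices. -/
def ramseyProp (n ℓ k : ℕ) : Prop :=
  ∀ C : Sym2 (Fin n) → Bool,
    (∃ s : Finset (Fin n), s.card = ℓ ∧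
      ∀ u ∈ s, ∀ v ∈ s, u ≠ v → C s(u, v) = true) ∨
    (∃ s : Finset (Fin n), s.card = k ∧
      ∀ u ∈ s, ∀ v ∈ s, u ≠ v → C s(u, v) = false)

/-- The Ramsey number `R(ℓ, k)`. -/
noncomputable def ramseyNumber (ℓ k : ℕ) : ℕ := sInf {n | ramseyProp n ℓ k}

open Finset in
theorem lovasz_local_lemma {Ω ι : Type*} [Fintype Ω] [DecidableEq Ω] [DecidableEq ι]
    (A : ι → Finset Ω) (I : Finset ι) (N : ι → Finset ι) (x : ι → ℝ)
    (hx0 : ∀ i, 0 ≤ x i) (hx1 : ∀ i, x i ≤ 1)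
    (h : ∀ i ∈ I, ∀ S ⊆ I, i ∉ S → Disjoint S (N i) →
      (#(A i \ S.biUnion A) : ℝ) ≤
        x i * (∏ j ∈ N i, (1 - x j)) * #(S.biUnion A)ᶜ) :
    (∏ j ∈ I, (1 - x j)) * Fintype.card Ω ≤ #(I.biUnion A)ᶜ := by
  set G : Finset ι → ℝ := fun S => #(S.biUnion A)ᶜ with hG
  have hx : ∀ i, 0 ≤ 1 - x i := fun i => sub_nonneg.2 (hx1 i)
  have split : ∀ i S, G (insert i S) + (#(A i \ S.biUnion A) : ℝ) = G S := by
    intro i S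
    simp only [hG]
    rw [← Nat.cast_add, add_comm, ← card_filter_add_card_filter_not
      (s := (S.biUnion A)ᶜ) (fun ω => ω ∈ A i)]
    congr 3
    · ext ω; simp [and_comm]
    · ext ω; simp [and_comm]
  have grow : ∀ T U : Finset ι, (∀ i ∈ U, ∀ V ⊆ T ∪ U, i ∉ V → V ≠ T ∪ U →
      (#(A i \ V.biUnion A) : ℝ) ≤ x i * G V) → Disjoint T U →
      (∏ j ∈ U, (1 - x j)) * G T ≤ G (T ∪ U) := by
    intro T U
    induction U using Finset.induction_on with
    | empty => simp
    | insert a U ha ih =>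
      intro hU hd
      have hd' := disjoint_insert_right.1 hd
      have haV : a ∉ T ∪ U := by simp [ha, hd'.1]
      have h1 := ih (fun i hi V hV hiV _ => hU i (mem_insert_of_mem hi) V
        (hV.trans (by grind)) hiV (by rintro rfl; grind)) hd'.2
      have h2 := hU a (mem_insert_self _ _) (T ∪ U) (by grind) haV (by intro h; grind)
      have h3 := split a (T ∪ U)
      rw [union_insert, prod_insert ha, mul_assoc]
      have h4 := mul_le_mul_of_nonneg_left h1 (hx a)
      linarith
  have key : ∀ n, ∀ S ⊆ I, #S = n → ∀ i ∈ I, i ∉ S →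
      (#(A i \ S.biUnion A) : ℝ) ≤ x i * G S := by
    intro n
    induction n using Nat.strong_induction_on with
    | _ n ih =>
    intro S hS hn i hi hiS
    have h1 := h i hi (S \ N i) (sdiff_subset.trans hS) (by grind) sdiff_disjoint
    have h2 := grow (S \ N i) (S ∩ N i) (fun j hj V hV hjV hne => by
      rw [sdiff_union_inter] at hV hne
      exact ih _ (hn ▸ card_lt_card (hV.ssubset_of_ne hne)) V (hV.trans hS) rfl j
        (hS (mem_inter.1 hj).1) hjV) (disjoint_sdiff_inter _ _)
    rw [sdiff_union_inter] at h2
    have h3 : (#(A i \ S.biUnion A) : ℝ) ≤ #(A i \ (S \ N i).biUnion A) := by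
      gcongr
      exact sdiff_subset
    have h4 : ∏ j ∈ N i, (1 - x j) ≤ ∏ j ∈ S ∩ N i, (1 - x j) := by
      apply prod_le_prod_of_subset_of_le_one <;> grind
    calc _ ≤ x i * (∏ j ∈ N i, (1 - x j)) * G (S \ N i) := h3.trans h1
      _ ≤ x i * ((∏ j ∈ S ∩ N i, (1 - x j)) * G (S \ N i)) := by
        rw [mul_assoc]
        exact mul_le_mul_of_nonneg_left
          (mul_le_mul_of_nonneg_right h4 (Nat.cast_nonneg _)) (hx0 i)
      _ ≤ _ := mul_le_mul_of_nonneg_left h2 (hx0 i)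
  have := grow ∅ I (fun i hi V hV hiV _ => key _ V (by simpa using hV) rfl i hi hiV)
    (disjoint_empty_left _)
  simpa [hG] using this

open Finset in
theorem card_filter_apply_mem {ι α : Type*} [Fintype ι] [DecidableEq ι] [Fintype α]
    [DecidableEq α] (B : Finset (ι → α)) (Q : Finset α) (a : ι)
    (hB : ∀ f ∈ B, ∀ c, Function.update f a c ∈ B) :
    #{f ∈ B | f a ∈ Q} * Fintype.card α = #Q * #B := by
  rw [← card_univ, ← card_product, ← card_product]
  apply card_nbij' (fun y => (y.1 a, Function.update y.1 a y.2))
    (fun y => (Function.update y.2 a y.1, y.2 a))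
  · rintro ⟨f, c⟩; simp +contextual [hB]
  · rintro ⟨c, f⟩; simp +contextual [hB]
  · rintro ⟨f, c⟩; simp
  · rintro ⟨c, f⟩; simp

open Finset in
theorem card_filter_forall_apply_mem {ι α : Type*} [Fintype ι] [DecidableEq ι] [Fintype α]
    [DecidableEq α] (B : Finset (ι → α)) (Q : Finset α) (D : Finset ι)
    (hB : ∀ f ∈ B, ∀ a ∈ D, ∀ c, Function.update f a c ∈ B) :
    #{f ∈ B | ∀ a ∈ D, f a ∈ Q} * Fintype.card α ^ #D = #Q ^ #D * #B := by
  induction D using Finset.induction_on with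
  | empty => simp
  | insert a D ha ih =>
    have h1 := ih (fun f hf b hb => hB f hf b (mem_insert_of_mem hb))
    have h2 := card_filter_apply_mem {f ∈ B | ∀ b ∈ D, f b ∈ Q} Q a (by
      intro f hf c
      simp only [mem_filter] at hf ⊢
      refine ⟨hB f hf.1 a (mem_insert_self _ _) c, fun b hb => ?_⟩
      rw [Function.update_of_ne (by rintro rfl; exact ha hb)]
      exact hf.2 b hb)
    have h3 : ({f ∈ B | ∀ b ∈ insert a D, f b ∈ Q} : Finset (ι → α)) =
        {f ∈ ({f ∈ B | ∀ b ∈ D, f b ∈ Q} : Finset (ι → α)) | f a ∈ Q} := by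
      ext f; simp; tauto
    rw [h3, card_insert_of_notMem ha, pow_succ, pow_succ, mul_comm (_ ^ _) (Fintype.card α),
      ← mul_assoc, h2, mul_assoc, h1]
    ring

open Finset in
theorem card_filter_two_le_card_inter {n : ℕ} (s : Finset (Fin n)) :
    #{t ∈ powersetCard 3 (univ : Finset (Fin n)) | 2 ≤ #(s ∩ t)} ≤ #s ^ 2 * n := by
  calc _ ≤ #((s ×ˢ s ×ˢ univ).image
        (fun y : Fin n × Fin n × Fin n => ({y.1, y.2.1, y.2.2} : Finset (Fin n)))) := by
        apply card_le_card
        intro t ht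
        simp only [mem_filter, mem_powersetCard, subset_univ, true_and] at ht
        obtain ⟨ht3, ht⟩ := ht
        obtain ⟨a, ha, b, hb, hab⟩ := one_lt_card.1 ht
        rw [mem_inter] at ha hb
        have hsub : ({a, b} : Finset (Fin n)) ⊆ t := by
          simp [insert_subset_iff, ha.2, hb.2]
        have hc : #(t \ {a, b}) = 1 := by
          rw [card_sdiff_of_subset hsub, card_pair hab, ht3]
        obtain ⟨c, hc⟩ := card_eq_one.1 hc
        refine mem_image.2 ⟨(a, b, c), by simp [ha.1, hb.1], ?_⟩
        rw [← sdiff_union_of_subset hsub, hc]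
        ext; simp; tauto
    _ ≤ _ := card_image_le.trans (by simp [sq, mul_assoc])

open Finset in
theorem not_ramseyProp_of_local_lemma (n m k : ℕ) [NeZero m] (x y : ℝ) (hx0 : 0 ≤ x) (hx1 : x < 1)
    (hy0 : 0 ≤ y) (hy1 : y < 1) (hk : k ≠ 3)
    (hxy : (1 / m : ℝ) ^ 3 ≤ x * ((1 - x) ^ (3 ^ 2 * n) * (1 - y) ^ n.choose k))
    (hyx : (1 - 1 / m : ℝ) ^ k.choose 2 ≤
      y * ((1 - x) ^ (k ^ 2 * n) * (1 - y) ^ n.choose k)) :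
    ¬ ramseyProp n 3 k := by
  let I : Finset (Finset (Fin n)) := powersetCard 3 univ ∪ powersetCard k univ
  let D : Finset (Fin n) → Finset (Sym2 (Fin n)) := fun s =>
    s.offDiag.image (Function.uncurry Sym2.mk)
  let Q : Finset (Fin n) → Finset (Fin m) := fun s => if #s = 3 then {0} else {0}ᶜ
  let A : Finset (Fin n) → Finset (Sym2 (Fin n) → Fin m) := fun s =>
    {f | ∀ e ∈ D s, f e ∈ Q s}
  let X : Finset (Fin n) → ℝ := fun s => if #s = 3 then x else y
  let N : Finset (Fin n) → Finset (Finset (Fin n)) := fun s => {t ∈ I | 2 ≤ #(s ∩ t)}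
  have hm : (0 : ℝ) < m := by exact_mod_cast NeZero.pos m
  have hDisj : ∀ s t : Finset (Fin n), ¬ 2 ≤ #(s ∩ t) → Disjoint (D s) (D t) := by
    intro s t hst
    rw [Finset.disjoint_left]
    intro e he he'
    induction e with | _ u v =>
    simp only [D, mem_image, mem_offDiag, Prod.exists, Function.uncurry, Sym2.eq_iff] at he he'
    refine hst (one_lt_card.2 ⟨u, ?_, v, ?_, ?_⟩) <;> grind
  have hX0 : ∀ s, 0 ≤ X s := fun s => by simp only [X]; split_ifs <;> assumption
  have hX1 : ∀ s, X s < 1 := fun s => by simp only [X]; split_ifs <;> assumption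
  have hprod : ∀ s, (1 - x) ^ (#s ^ 2 * n) * (1 - y) ^ n.choose k ≤ ∏ t ∈ N s, (1 - X t) := by
    intro s
    rw [← prod_filter_mul_prod_filter_not (N s) (fun t => #t = 3)]
    have h1 : ∏ t ∈ N s with #t = 3, (1 - X t) = (1 - x) ^ #{t ∈ N s | #t = 3} := by
      rw [← prod_const]
      exact prod_congr rfl fun t ht => by simp [X, (mem_filter.1 ht).2]
    have h2 : ∏ t ∈ N s with ¬ #t = 3, (1 - X t) = (1 - y) ^ #{t ∈ N s | ¬ #t = 3} := by
      rw [← prod_const]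
      exact prod_congr rfl fun t ht => by simp [X, (mem_filter.1 ht).2]
    rw [h1, h2]
    have h3 : #{t ∈ N s | #t = 3} ≤ #s ^ 2 * n := by
      refine le_trans (card_le_card ?_) (card_filter_two_le_card_inter s)
      intro t ht
      simp only [N, I, mem_filter, mem_union, mem_powersetCard, subset_univ, true_and] at ht ⊢
      exact ⟨ht.2, ht.1.2⟩
    have h4 : #{t ∈ N s | ¬ #t = 3} ≤ n.choose k := by
      calc _ ≤ #(powersetCard k (univ : Finset (Fin n))) := by
            apply card_le_card
            intro t ht
            simp only [N, I, mem_filter, mem_union, mem_powersetCard, subset_univ,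
              true_and] at ht ⊢
            tauto
        _ = _ := by simp
    exact mul_le_mul (pow_le_pow_of_le_one (by linarith) (by linarith) h3)
      (pow_le_pow_of_le_one (by linarith) (by linarith) h4)
      (pow_nonneg (by linarith) _) (pow_nonneg (by linarith) _)
  have hlll := lovasz_local_lemma A I N X hX0 (fun s => (hX1 s).le) (by
    intro s hs S hS _ hSN
    have hcard := card_filter_forall_apply_mem
      (S.biUnion A)ᶜ (Q s) (D s) (by
        intro f hf a ha c
        simp only [mem_compl, mem_biUnion, not_exists, not_and] at hf ⊢
        intro t ht hft
        refine hf t ht ?_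
        simp only [A, mem_filter, mem_univ, true_and] at hft ⊢
        intro e he
        have hdis : Disjoint (D s) (D t) := hDisj s t fun h2 =>
          Finset.disjoint_left.1 hSN ht (mem_filter.2 ⟨hS ht, h2⟩)
        have := hft e he
        rwa [Function.update_of_ne] at this
        rintro rfl
        exact Finset.disjoint_left.1 hdis ha he)
    have heq : A s \ S.biUnion A = {f ∈ (S.biUnion A)ᶜ | ∀ a ∈ D s, f a ∈ Q s} := by
      ext f; simp only [A, mem_sdiff, mem_filter, mem_compl, mem_univ, true_and, and_comm]
    have hDc : #(D s) = (#s).choose 2 := Sym2.card_image_offDiag s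
    rw [heq]
    generalize (S.biUnion A)ᶜ = G at hcard ⊢
    have hcard' : (#{f ∈ G | ∀ a ∈ D s, f a ∈ Q s} : ℝ) =
        (#(Q s) / m : ℝ) ^ #(D s) * #G := by
      have : (#{f ∈ G | ∀ a ∈ D s, f a ∈ Q s} : ℝ) * m ^ #(D s) =
        (#(Q s) : ℝ) ^ #(D s) * #G := by
        rw [Fintype.card_fin] at hcard
        exact_mod_cast hcard
      rw [div_pow, div_mul_eq_mul_div, ← this, mul_div_assoc, div_self (by positivity), mul_one]
    rw [hcard']
    refine mul_le_mul_of_nonneg_right ?_ (Nat.cast_nonneg _)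
    refine le_trans ?_ (mul_le_mul_of_nonneg_left (hprod s) (hX0 s))
    rw [hDc]
    by_cases h3 : #s = 3
    · simpa [X, Q, h3, Nat.choose] using hxy
    · have hsk : #s = k := by
        simp only [I, mem_union, mem_powersetCard, subset_univ, true_and] at hs
        tauto
      have hQ : (#(Q s) / m : ℝ) = 1 - 1 / m := by
        simp only [Q, if_neg h3, card_compl, card_singleton, Fintype.card_fin]
        rw [Nat.cast_sub (NeZero.one_le), sub_div, div_self hm.ne', Nat.cast_one]
      rw [hQ, hsk]
      simpa [X, h3] using hyx)
  have hpos : 0 < (#(I.biUnion A)ᶜ : ℝ) := by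
    refine lt_of_lt_of_le (mul_pos (prod_pos fun s _ => sub_pos.2 (hX1 s)) ?_) hlll
    exact_mod_cast Fintype.card_pos
  obtain ⟨f, hf⟩ := card_pos.1 (Nat.cast_pos.1 hpos)
  simp only [mem_compl, mem_biUnion, not_exists, not_and] at hf
  intro hR
  have hD : ∀ (s : Finset (Fin n)) (P : Sym2 (Fin n) → Prop),
      (∀ u ∈ s, ∀ v ∈ s, u ≠ v → P s(u, v)) → ∀ e ∈ D s, P e := by
    intro s P h e he
    simp only [D, mem_image, Prod.exists] at he
    obtain ⟨u, v, huv, rfl⟩ := he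
    rw [mem_offDiag] at huv
    exact h u huv.1 v huv.2.1 huv.2.2
  rcases hR (fun e => decide (f e = 0)) with ⟨s, hs, h⟩ | ⟨s, hs, h⟩
  · refine hf s (by simp [I, hs]) ?_
    simp only [A, mem_filter, mem_univ, true_and]
    exact hD s _ fun u hu v hv huv => by simpa [Q, hs] using h u hu v hv huv
  · refine hf s (by simp [I, hs]) ?_
    simp only [A, mem_filter, mem_univ, true_and]
    exact hD s _ fun u hu v hv huv => by simpa [Q, hs, hk] using h u hu v hv huv

theorem exp_neg_le_one_sub {x : ℝ} (hx0 : 0 ≤ x) (hx : x ≤ 1 / 2) :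
    Real.exp (-(2 * x)) ≤ 1 - x := by
  rw [Real.exp_neg, inv_le_comm₀ (Real.exp_pos _) (by linarith)]
  refine le_trans ?_ (Real.add_one_le_exp _)
  rw [inv_le_iff_one_le_mul₀ (by linarith)]
  nlinarith

theorem not_ramseyProp_sq (r k : ℕ) (hr : 1 ≤ r) (hk : 4 ≤ k)
    (h : 128 * r * Real.log k ≤ k) : ¬ ramseyProp (r ^ 2) 3 k := by
  have hr' : (1 : ℝ) ≤ r := by exact_mod_cast hr
  have hk' : (4 : ℝ) ≤ k := by exact_mod_cast hk
  have hlogk : 1 ≤ Real.log k := by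
    rw [Real.le_log_iff_exp_le (by linarith)]
    linarith [Real.exp_one_lt_d9]
  have hrk : (r : ℝ) ≤ k := by nlinarith
  have hlogr : Real.log r ≤ Real.log k := Real.log_le_log (by linarith) hrk
  have hr0 : (0 : ℝ) < r := by linarith
  have : NeZero (8 * r) := ⟨by omega⟩
  set x : ℝ := 1 / (64 * r ^ 3) with hx
  set y : ℝ := 1 / (2 * (r ^ 2) ^ k) with hy
  have hr3 : (1 : ℝ) ≤ r ^ 3 := one_le_pow₀ hr'
  have hrk1 : (1 : ℝ) ≤ (r ^ 2) ^ k := one_le_pow₀ (one_le_pow₀ hr')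
  have hx0 : 0 ≤ x := by positivity
  have hy0 : 0 ≤ y := by positivity
  have hx1 : x ≤ 1 / 2 := by
    rw [hx]; exact one_div_le_one_div_of_le (by norm_num) (by linarith)
  have hy1 : y ≤ 1 / 2 := by
    rw [hy]; exact one_div_le_one_div_of_le (by norm_num) (by linarith)
  have hY : 1 / 2 ≤ (1 - y) ^ (r ^ 2).choose k := by
    have h1 := one_add_mul_le_pow (a := -y) (by linarith) ((r ^ 2).choose k)
    have h2 : (((r ^ 2).choose k : ℕ) : ℝ) ≤ (r ^ 2) ^ k := by
      exact_mod_cast Nat.choose_le_pow _ _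
    have h3 : (((r ^ 2).choose k : ℕ) : ℝ) * y ≤ 1 / 2 := by
      refine (mul_le_mul_of_nonneg_right h2 hy0).trans (le_of_eq ?_)
      rw [hy]; field_simp
    rw [← sub_eq_add_neg] at h1
    linarith
  apply not_ramseyProp_of_local_lemma (r ^ 2) (8 * r) k x y hx0 (by linarith) hy0 (by linarith)
    (by omega)
  · have hX : 1 / 2 ≤ (1 - x) ^ (3 ^ 2 * r ^ 2) := by
      have h1 := one_add_mul_le_pow (a := -x) (by linarith) (3 ^ 2 * r ^ 2)
      have h3 : ((3 ^ 2 * r ^ 2 : ℕ) : ℝ) * x ≤ 1 / 2 := by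
        rw [hx, mul_one_div, div_le_iff₀ (by positivity)]
        push_cast
        nlinarith [sq_nonneg (r : ℝ)]
      rw [← sub_eq_add_neg, mul_neg] at h1
      refine le_trans ?_ h1
      linarith
    calc (1 / ((8 * r : ℕ) : ℝ)) ^ 3 = x * (1 / 8) := by
          rw [hx]; push_cast; field_simp; norm_num
      _ ≤ x * (1 / 2 * (1 / 2)) := by gcongr; norm_num
      _ ≤ _ := by gcongr
  · have hX : Real.exp (-((k : ℝ) ^ 2 / (32 * r))) ≤ (1 - x) ^ (k ^ 2 * r ^ 2) := by
      refine le_trans (le_of_eq ?_)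
        (pow_le_pow_left₀ (Real.exp_pos _).le (exp_neg_le_one_sub hx0 hx1) _)
      rw [← Real.exp_nat_mul, hx]
      congr 1
      push_cast
      field_simp
      norm_num
    have hL : (1 - 1 / ((8 * r : ℕ) : ℝ)) ^ k.choose 2 ≤
        Real.exp (-((k : ℝ) * (k - 1) / (16 * r))) := by
      have h8 : 1 / ((8 * r : ℕ) : ℝ) ≤ 1 := by
        push_cast
        rw [div_le_one (by positivity)]
        linarith
      refine (pow_le_pow_left₀ (by linarith) (Real.one_sub_le_exp_neg _) _).trans (le_of_eq ?_)
      rw [← Real.exp_nat_mul, Nat.cast_choose_two]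
      congr 1
      push_cast
      field_simp
      ring
    have hyexp : y = Real.exp (-(Real.log 2 + k * (2 * Real.log r))) := by
      have h2 : 2 * Real.log r = Real.log r + Real.log r := two_mul _
      rw [h2, Real.exp_neg, Real.exp_add, Real.exp_log (by norm_num), Real.exp_nat_mul,
        Real.exp_add, Real.exp_log hr0, hy, one_div, sq]
    have hhalf : Real.exp (-1) ≤ 1 / 2 := by
      rw [Real.exp_neg, one_div]
      exact inv_anti₀ (by norm_num) (by linarith [Real.exp_one_gt_d9])
    calc _ ≤ Real.exp (-((k : ℝ) * (k - 1) / (16 * r))) := hL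
      _ ≤ Real.exp (-(Real.log 2 + k * (2 * Real.log r)) +
            (-((k : ℝ) ^ 2 / (32 * r)) + -1)) := by
          rw [Real.exp_le_exp]
          have e1 : (k : ℝ) * (k - 1) / (16 * r) =
              2 * ((k : ℝ) * (k / (32 * r))) - k * (1 / (16 * r)) := by field_simp; ring
          have e2 : (k : ℝ) ^ 2 / (32 * r) = k * (k / (32 * r)) := by field_simp
          have e3 : 4 * Real.log k ≤ k / (32 * r) := by
            rw [le_div_iff₀ (by positivity)]; linarith
          have e4 : 1 / (16 * r : ℝ) ≤ 1 / 16 :=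
            one_div_le_one_div_of_le (by norm_num) (by linarith)
          have e5 := Real.log_two_lt_d9
          have e6 : 0 ≤ (k : ℝ) * (k / (32 * r) - 2 * Real.log r - 1 / (16 * r) - 1) :=
            mul_nonneg (by linarith) (by linarith)
          rw [e1, e2]
          linarith
      _ = y * (Real.exp (-((k : ℝ) ^ 2 / (32 * r))) * Real.exp (-1)) := by
          rw [hyexp, ← Real.exp_add, ← Real.exp_add]
      _ ≤ _ := by
          have hX' := (Real.exp_pos _).le.trans hX
          have := hhalf.trans hY
          gcongr

theorem ramseyProp.mono {n n' ℓ k : ℕ} (hn : n ≤ n') (h : ramseyProp n ℓ k) :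
    ramseyProp n' ℓ k := by
  intro C
  rcases h (fun e => C (e.map (Fin.castLE hn))) with ⟨s, hs, h⟩ | ⟨s, hs, h⟩
  · exact Or.inl ⟨s.map (Fin.castLEEmb hn), by simpa using hs, by simpa using h⟩
  · exact Or.inr ⟨s.map (Fin.castLEEmb hn), by simpa using hs, by simpa using h⟩

open Finset in
theorem exists_blue_triangle_or_red_clique {α : Type*} [DecidableEq α] (C : Sym2 α → Bool)
    (k : ℕ) (s : Finset α) (hs : k ^ 2 ≤ #s) :
    (∃ t ⊆ s, #t = 3 ∧ ∀ u ∈ t, ∀ v ∈ t, u ≠ v → C s(u, v) = true) ∨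
      ∃ t ⊆ s, #t = k ∧ ∀ u ∈ t, ∀ v ∈ t, u ≠ v → C s(u, v) = false := by
  induction k generalizing s with
  | zero => exact Or.inr ⟨∅, by simp⟩
  | succ k ih =>
    obtain ⟨v, hv⟩ : s.Nonempty := card_pos.1 ((Nat.pow_pos k.succ_pos).trans_le hs)
    by_cases hB : k + 1 ≤ #{u ∈ s.erase v | C s(v, u) = true}
    · obtain ⟨t, ht, htk⟩ := exists_subset_card_eq hB
      have htB : ∀ u ∈ t, u ≠ v ∧ u ∈ s ∧ C s(v, u) = true := fun u hu => by
        simpa [and_assoc] using ht hu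
      by_cases hred : ∀ u ∈ t, ∀ w ∈ t, u ≠ w → C s(u, w) = false
      · exact Or.inr ⟨t, fun u hu => (htB u hu).2.1, htk, hred⟩
      · push Not at hred
        obtain ⟨u, hu, w, hw, huw, hC⟩ := hred
        obtain ⟨hu1, hu2, hu3⟩ := htB u hu
        obtain ⟨hw1, hw2, hw3⟩ := htB w hw
        refine Or.inl ⟨{v, u, w}, by simp [insert_subset_iff, *],
          card_eq_three.2 ⟨v, u, w, hu1.symm, hw1.symm, huw, rfl⟩, ?_⟩
        have := Sym2.eq_swap (a := u) (b := w)
        have := Sym2.eq_swap (a := v) (b := w)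
        have := Sym2.eq_swap (a := u) (b := v)
        simp only [mem_insert, mem_singleton]
        grind
    · have hcard := card_filter_add_card_filter_not (s := s.erase v) (fun u => C s(v, u) = true)
      rw [card_erase_of_mem hv] at hcard
      have hsub : ({u ∈ s.erase v | ¬ C s(v, u) = true} : Finset α) ⊆ s :=
        (filter_subset _ _).trans (erase_subset _ _)
      rcases ih {u ∈ s.erase v | ¬ C s(v, u) = true} (by
        have : (k + 1) ^ 2 = k ^ 2 + 2 * k + 1 := by ring
        omega) with ⟨t, ht, h⟩ | ⟨t, ht, htk, h⟩
      · exact Or.inl ⟨t, ht.trans hsub, h⟩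
      · have htB : ∀ u ∈ t, u ≠ v ∧ u ∈ s ∧ C s(v, u) = false := fun u hu => by
          simpa [and_assoc] using ht hu
        refine Or.inr ⟨insert v t, insert_subset hv (ht.trans hsub), ?_, ?_⟩
        · rw [card_insert_of_notMem fun hvt => (htB v hvt).1 rfl, htk]
        · intro u hu w hw huw
          have := Sym2.eq_swap (a := u) (b := w)
          grind

theorem ramseyProp_three_sq (k : ℕ) : ramseyProp (k ^ 2) 3 k := by
  intro C
  rcases exists_blue_triangle_or_red_clique C k Finset.univ (by simp) with
    ⟨t, _, h⟩ | ⟨t, _, h⟩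
  · exact Or.inl ⟨t, h⟩
  · exact Or.inr ⟨t, h⟩

/-- There are a positive constant `c` and an integer `K` such that for all `k ≥ K`
the off-diagonal Ramsey number satisfies `R(3,k) ≥ c · (k / log k)²`. -/
theorem stmt_10 :
    ∃ c : ℝ, 0 < c ∧ ∃ K : ℕ, ∀ k : ℕ, K ≤ k →
      c * ((k : ℝ) / Real.log k) ^ 2 ≤ (ramseyNumber 3 k : ℝ) := by
  have hlim := Real.isLittleO_log_id_atTop.bound (c := 1 / 128) (by norm_num)
  obtain ⟨K, hK⟩ := Filter.eventually_atTop.1 (tendsto_natCast_atTop_atTop.eventually hlim)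
  refine ⟨(1 / 256) ^ 2, by norm_num, max K 4, fun k hk => ?_⟩
  have hk4 : 4 ≤ k := (le_max_right _ _).trans hk
  have hk' : (4 : ℝ) ≤ k := by exact_mod_cast hk4
  have hlog : 0 < Real.log k := Real.log_pos (by linarith)
  have hlogk : Real.log k ≤ 1 / 128 * k := by
    have := hK k ((le_max_left _ _).trans hk)
    rwa [Real.norm_of_nonneg hlog.le, id, Real.norm_of_nonneg (by linarith)] at this
  set z : ℝ := k / (128 * Real.log k) with hz
  have hz1 : 1 ≤ z := by
    rw [hz, le_div_iff₀ (by positivity)]; linarith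
  have hr1 : 1 ≤ ⌊z⌋₊ := Nat.le_floor (by exact_mod_cast hz1)
  have hrz : (⌊z⌋₊ : ℝ) ≤ z := Nat.floor_le (by linarith)
  have hzr : z ≤ 2 * ⌊z⌋₊ := by
    have h1 := Nat.lt_floor_add_one z
    have h2 : (1 : ℝ) ≤ ⌊z⌋₊ := by exact_mod_cast hr1
    linarith
  have hnot := not_ramseyProp_sq ⌊z⌋₊ k hr1 hk4 (by
    rw [hz, le_div_iff₀ (by positivity)] at hrz
    linarith)
  have hmem : ramseyProp (ramseyNumber 3 k) 3 k :=
    Nat.sInf_mem (s := {n | ramseyProp n 3 k}) ⟨_, ramseyProp_three_sq k⟩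
  have hlt : ⌊z⌋₊ ^ 2 < ramseyNumber 3 k := by
    by_contra! hle
    exact hnot (hmem.mono hle)
  calc _ = (z / 2) ^ 2 := by
        rw [← mul_pow, hz]; congr 1; field_simp; norm_num
    _ ≤ (⌊z⌋₊ : ℝ) ^ 2 := by
        gcongr; linarith
    _ ≤ _ := by exact_mod_cast hlt.le
end

section
/- Let (a_{ij})_{i,j ≥ 1} be a doubly-indexed collection of non-negative real numbers with 0 < Σ_{i,j=1}^∞ a_{ij} < ∞. For i, j ≥ 1 define b_{ij} := a_{ij} / ( Σ_{k=1}^∞ Σ_{ℓ=1}^{i+j−1} a_{kℓ} ), with the convention 0/0 = 0. Then for every real x > 0 one has 1 + Σ_{i=1}^∞ ( sup_{j ≥ 1} b_{ij} ) · xⁱ > x, where the left-hand side is interpreted in [0,∞] (the inequality holds in particular when the series diverges). -/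
open ENNReal

/-- A bounded sequence `s` with `s 0 = 0` satisfying `s (j + 1) ≤ s j + ∑ c i * s (i + j + 1)`
vanishes, provided `1 + ∑ c i * x ^ (i + 1) ≤ x` for some `x > 1`. -/
theorem eq_zero_of_bounded_of_le_add_tsum {s c : ℕ → ℝ≥0∞} {T : ℝ≥0∞} (hT : T ≠ ⊤)
    (hsT : ∀ n, s n ≤ T) (hs0 : s 0 = 0)
    (hs : ∀ j, s (j + 1) ≤ s j + ∑' i, c i * s (i + j + 1))
    {x : ℝ} (hx : 1 < x)
    (hc : 1 + ∑' i, c i * ENNReal.ofReal x ^ (i + 1) ≤ ENNReal.ofReal x) (n : ℕ) :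
    s n = 0 := by
  by_contra hn
  have hfin : ∀ n, s n ≠ ⊤ := fun n => ne_top_of_le_ne_top hT (hsT n)
  have hx0 : 0 < x := by linarith
  set X := ENNReal.ofReal x with hX
  have hX0 : X ≠ 0 := by simpa [hX] using hx0
  have hXt : X ≠ ⊤ := ENNReal.ofReal_ne_top
  have hpow0 : ∀ n, X ^ n ≠ 0 := fun n => pow_ne_zero n hX0
  have hpowt : ∀ n, X ^ n ≠ ⊤ := fun n => ENNReal.pow_ne_top hXt
  have htoReal : ∀ n, (s n / X ^ n).toReal = (s n).toReal / x ^ n := fun n => by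
    rw [ENNReal.toReal_div, ENNReal.toReal_pow, hX, ENNReal.toReal_ofReal hx0.le]
  have hdivt : ∀ n, s n / X ^ n ≠ ⊤ := fun n => ENNReal.div_ne_top (hfin n) (hpow0 n)
  have hlim : Filter.Tendsto (fun n => (s n / X ^ n).toReal) Filter.atTop (nhds 0) := by
    have hgeom : Filter.Tendsto (fun n : ℕ => T.toReal * (x⁻¹) ^ n) Filter.atTop (nhds 0) := by
      simpa using (tendsto_pow_atTop_nhds_zero_of_lt_one (inv_nonneg.2 hx0.le)
        (inv_lt_one_of_one_lt₀ hx)).const_mul T.toReal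
    refine squeeze_zero (fun _ => ENNReal.toReal_nonneg) (fun n => ?_) hgeom
    rw [htoReal, inv_pow, ← div_eq_mul_inv]
    have := ENNReal.toReal_mono hT (hsT n)
    gcongr
  have hnpos : 0 < (s n / X ^ n).toReal :=
    ENNReal.toReal_pos (ENNReal.div_ne_zero.2 ⟨hn, hpowt n⟩) (hdivt n)
  obtain ⟨m, hm⟩ := (continuous_of_discreteTopology
      (f := fun n => (s n / X ^ n).toReal)).exists_forall_ge' n (by
    rw [Filter.cocompact_eq_cofinite, Nat.cofinite_eq_atTop]
    exact (hlim.eventually_lt_const hnpos).mono fun _ h => h.le)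
  set M := s m / X ^ m with hM
  have hMt : M ≠ ⊤ := hdivt m
  have hM0 : M ≠ 0 := by
    intro h
    have := hm n
    simp only [h, ENNReal.toReal_zero] at this
    linarith
  have hle : ∀ k, s k ≤ M * X ^ k := fun k => by
    rw [← ENNReal.div_le_iff (hpow0 k) (hpowt k)]
    exact (ENNReal.toReal_le_toReal (hdivt k) hMt).1 (hm k)
  have hdescend : ∀ k, ¬ M * X ^ k ≤ s k := by
    intro k
    induction k with
    | zero => simpa [hs0] using hM0
    | succ j ih =>
      intro h
      apply ih
      set D := ∑' i, c i * X ^ (i + 1) with hD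
      have hDt : D ≠ ⊤ := ne_top_of_le_ne_top hXt (le_add_self.trans hc)
      have hsum : ∑' i, c i * s (i + j + 1) ≤ M * X ^ j * D := by
        rw [hD, ← ENNReal.tsum_mul_left]
        refine ENNReal.tsum_le_tsum fun i => ?_
        calc c i * s (i + j + 1) ≤ c i * (M * X ^ (i + j + 1)) := by gcongr; exact hle _
          _ = M * X ^ j * (c i * X ^ (i + 1)) := by ring
      refine ENNReal.le_of_add_le_add_right
        (ENNReal.mul_ne_top (ENNReal.mul_ne_top hMt (hpowt j)) hDt) ?_
      calc M * X ^ j + M * X ^ j * D = M * X ^ j * (1 + D) := by ring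
        _ ≤ M * X ^ j * X := by gcongr
        _ = M * X ^ (j + 1) := by ring
        _ ≤ s (j + 1) := h
        _ ≤ s j + ∑' i, c i * s (i + j + 1) := hs j
        _ ≤ s j + M * X ^ j * D := by gcongr
  exact hdescend m (ENNReal.div_mul_cancel (hpow0 m) (hpowt m)).le

/-- Let `(a_{ij})_{i,j ≥ 1}` be non-negative reals (here elements of `ℝ≥0∞`, with the
hypothesis that their total sum is finite and positive) and set
`b_{ij} := a_{ij} / (Σ_{k=1}^∞ Σ_{ℓ=1}^{i+j-1} a_{kℓ})` (division in `ℝ≥0∞`, so `0/0 = 0`).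
Then for every real `x > 0` we have `1 + Σ_{i=1}^∞ (sup_{j ≥ 1} b_{ij}) xⁱ > x`, the
left-hand side being interpreted in `[0,∞]`.  Indices are shifted: `a (i+1) (j+1)`
plays the role of `a_{ij}` for `i, j ≥ 0`, and `(i+1)+(j+1)-1 = i+j+1`. -/
theorem stmt_11 (a : ℕ → ℕ → ℝ≥0∞)
    (hpos : 0 < ∑' i : ℕ, ∑' j : ℕ, a (i + 1) (j + 1))
    (hfin : ∑' i : ℕ, ∑' j : ℕ, a (i + 1) (j + 1) < ⊤)
    (b : ℕ → ℕ → ℝ≥0∞)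
    (hb : ∀ i j : ℕ,
      b i j = a (i + 1) (j + 1) /
        ∑' k : ℕ, ∑ ℓ ∈ Finset.Icc 1 (i + j + 1), a (k + 1) ℓ) :
    ∀ x : ℝ, 0 < x →
      ENNReal.ofReal x < 1 + ∑' i : ℕ, (⨆ j : ℕ, b i j) * ENNReal.ofReal x ^ (i + 1) := by
  intro x hx
  by_contra! hc
  set s : ℕ → ℝ≥0∞ := fun n => ∑' k : ℕ, ∑ ℓ ∈ Finset.Icc 1 n, a (k + 1) ℓ with hs
  set c : ℕ → ℝ≥0∞ := fun i => ⨆ j : ℕ, b i j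
  have hsT : ∀ n, s n ≤ ∑' i : ℕ, ∑' j : ℕ, a (i + 1) (j + 1) := fun n => by
    refine ENNReal.tsum_le_tsum fun k => ?_
    rw [← Finset.Ico_add_one_right_eq_Icc, Finset.sum_Ico_eq_sum_range]
    simpa [add_comm 1] using ENNReal.sum_le_tsum (f := fun j => a (k + 1) (j + 1)) (Finset.range n)
  have has : ∀ i j n, j < n → a (i + 1) (j + 1) ≤ s n := fun i j n hj =>
    (Finset.single_le_sum (f := fun ℓ => a (i + 1) ℓ) (fun _ _ => zero_le)
      (Finset.mem_Icc.2 ⟨by omega, by omega⟩)).trans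
      (ENNReal.le_tsum (f := fun k => ∑ ℓ ∈ Finset.Icc 1 n, a (k + 1) ℓ) i)
  have hac : ∀ i j, a (i + 1) (j + 1) ≤ c i * s (i + j + 1) := fun i j => by
    have hle := has i j (i + j + 1) (by omega)
    by_cases h0 : s (i + j + 1) = 0
    · rw [h0] at hle ⊢
      simpa using hle
    · calc a (i + 1) (j + 1) = b i j * s (i + j + 1) := by
            rw [hb]
            exact (ENNReal.div_mul_cancel h0 (ne_top_of_le_ne_top hfin.ne (hsT _))).symm
        _ ≤ c i * s (i + j + 1) := by gcongr; exact le_iSup (b i) j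
  have ha : ∃ i j, a (i + 1) (j + 1) ≠ 0 := by
    by_contra! h
    simp [h] at hpos
  obtain ⟨i, j, hij⟩ := ha
  have hone : 1 ≤ x := by
    simpa using le_self_add.trans hc
  rcases hone.eq_or_lt with rfl | hlt
  · have hsum : ∑' i, c i = 0 := by
      simpa using ENNReal.le_of_add_le_add_left ENNReal.one_ne_top
        (a := 1) (b := ∑' i, c i) (c := 0) (by simpa using hc)
    have hci := ENNReal.tsum_eq_zero.1 hsum i
    exact hij (by simpa [hci] using hac i j)
  · have hstep : ∀ j, s (j + 1) ≤ s j + ∑' i, c i * s (i + j + 1) := fun j => by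
      have : s (j + 1) = s j + ∑' k, a (k + 1) (j + 1) := by
        simp only [hs]
        rw [← ENNReal.tsum_add]
        exact tsum_congr fun k => Finset.sum_Icc_succ_top (by omega) _
      rw [this]
      gcongr with k
      exact hac k j
    have hzero := eq_zero_of_bounded_of_le_add_tsum hfin.ne hsT (by simp [hs]) hstep hlt hc (j + 1)
    exact hij (by simpa [hzero] using has i j (j + 1) (by omega))
end

section
/- Let (a_j)_{j ≥ 1} be a sequence of non-negative real numbers with 0 < Σ_{j=1}^∞ a_j < ∞, and let k be a positive integer. Then sup_{j ≥ 1} ( a_j / Σ_{i=1}^{j+k−1} a_i ) > 1/(e·k). -/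
open Filter Topology

/-- The rate `u = exp (-1/k)` satisfies `1/(e·k) ≤ (1 - u) * u ^ (k - 1)`, here with `k = m + 1`. -/
lemma exists_inv_exp_mul_le_one_sub_mul_pow (m : ℕ) :
    ∃ u : ℝ, 0 < u ∧ u < 1 ∧
      1 / (Real.exp 1 * ((m + 1 : ℕ) : ℝ)) ≤ (1 - u) * u ^ m := by
  set t : ℝ := 1 / ((m + 1 : ℕ) : ℝ) with ht
  have htpos : 0 < t := by positivity
  refine ⟨Real.exp (-t), Real.exp_pos _, Real.exp_lt_one_iff.2 (by linarith), ?_⟩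
  have hmt : (m : ℝ) * t = 1 - t := by
    rw [ht]; push_cast; field_simp; ring
  have hpow : Real.exp (-t) ^ m = Real.exp (-1) * Real.exp t := by
    rw [← Real.exp_nat_mul, ← Real.exp_add]
    congr 1
    linarith
  have hcancel : Real.exp (-t) * Real.exp t = 1 := by
    rw [← Real.exp_add]; simp
  have hlhs : 1 / (Real.exp 1 * ((m + 1 : ℕ) : ℝ)) = Real.exp (-1) * t := by
    rw [ht, Real.exp_neg]; field_simp
  calc 1 / (Real.exp 1 * ((m + 1 : ℕ) : ℝ)) = Real.exp (-1) * t := hlhs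
    _ ≤ Real.exp (-1) * (Real.exp t - 1) := by
        gcongr
        linarith [Real.add_one_le_exp t]
    _ = (1 - Real.exp (-t)) * Real.exp (-t) ^ m := by
        rw [hpow]; linear_combination Real.exp (-1) * hcancel

/-- If a non-negative sequence with positive limit has increments
`S (j + 1) - S j ≤ c * S (j + 1 + m)` with `c ≤ (1 - u) * u ^ m`, then consecutive ratios
are at least `u`. -/
lemma mul_succ_le_of_increment_le {S : ℕ → ℝ} {L u c : ℝ} {m : ℕ} (hS : ∀ n, 0 ≤ S n)
    (hlim : Tendsto S atTop (𝓝 L)) (hL : 0 < L) (hu0 : 0 < u) (hu1 : u < 1)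
    (hc : c ≤ (1 - u) * u ^ m) (hinc : ∀ j, S (j + 1) - S j ≤ c * S (j + 1 + m)) (j : ℕ) :
    u * S (j + 1) ≤ S j := by
  have hev : ∀ᶠ n in atTop, u * S (n + 1) < S n := by
    refine Tendsto.eventually_lt (((tendsto_add_atTop_iff_nat 1).2 hlim).const_mul u) hlim ?_
    nlinarith
  obtain ⟨N, hN⟩ := eventually_atTop.1 hev
  have hback : ∀ n, (∀ i, n + 1 ≤ i → u * S (i + 1) ≤ S i) → ∀ i, n ≤ i → u * S (i + 1) ≤ S i := by
    intro n hn i hi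
    rcases hi.eq_or_lt with rfl | hlt
    · have hiter : ∀ p, u ^ p * S (n + 1 + p) ≤ S (n + 1) := by
        intro p
        induction p with
        | zero => simp
        | succ p ih =>
          calc u ^ (p + 1) * S (n + 1 + (p + 1)) = u ^ p * (u * S (n + 1 + p + 1)) := by
                rw [← add_assoc]; ring
            _ ≤ u ^ p * S (n + 1 + p) := by
                gcongr
                exact hn _ (by omega)
            _ ≤ S (n + 1) := ih
      have hle : c * S (n + 1 + m) ≤ (1 - u) * S (n + 1) :=
        calc c * S (n + 1 + m) ≤ (1 - u) * u ^ m * S (n + 1 + m) :=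
              mul_le_mul_of_nonneg_right hc (hS _)
          _ = (1 - u) * (u ^ m * S (n + 1 + m)) := by ring
          _ ≤ (1 - u) * S (n + 1) := mul_le_mul_of_nonneg_left (hiter m) (by linarith)
      linarith [hinc n]
    · exact hn i hlt
  have hall : ∀ i, 0 ≤ i → u * S (i + 1) ≤ S i :=
    Nat.decreasingInduction (motive := fun n _ => ∀ i, n ≤ i → u * S (i + 1) ≤ S i)
      (fun n _ h => hback n h) (fun i hi => (hN i hi).le) (Nat.zero_le N)
  exact hall j (Nat.zero_le j)


/-- Let `(a_j)_{j ≥ 1}` be a sequence of non-negative reals with `0 < Σ_{j=1}^∞ a_j < ∞`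
and let `k` be a positive integer.  Then
`sup_{j ≥ 1} ( a_j / Σ_{i=1}^{j+k-1} a_i ) > 1/(e·k)`.
Here `a (j+1)` plays the role of `a_j` (indices shifted so that they start at `1`),
and `Σ_{i=1}^{(j+1)+k-1} a_i = Σ_{i ∈ Icc 1 (j+k)} a_i`. -/
theorem stmt_12 (a : ℕ → ℝ) (ha : ∀ j, 0 ≤ a j)
    (hsummable : Summable fun j : ℕ => a (j + 1))
    (hpos : 0 < ∑' j : ℕ, a (j + 1))
    (k : ℕ) (hk : 1 ≤ k) :
    1 / (Real.exp 1 * k) < ⨆ j : ℕ, a (j + 1) / ∑ i ∈ Finset.Icc 1 (j + k), a i := by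
  obtain ⟨m, rfl⟩ : ∃ m, k = m + 1 := ⟨k - 1, by omega⟩
  set S : ℕ → ℝ := fun n => ∑ i ∈ Finset.Icc 1 n, a i with hSdef
  have hS : ∀ n, 0 ≤ S n := fun n => Finset.sum_nonneg fun i _ => ha i
  have hsucc : ∀ n, S (n + 1) = S n + a (n + 1) := fun n =>
    Finset.sum_Icc_succ_top (by omega) a
  have hrange : ∀ n, ∑ i ∈ Finset.range n, a (i + 1) = S n := by
    intro n
    induction n with
    | zero => simp [hSdef]
    | succ n ih => rw [Finset.sum_range_succ, ih, hsucc]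
  have hlim : Tendsto S atTop (𝓝 (∑' j : ℕ, a (j + 1))) := by
    simpa only [hrange] using hsummable.hasSum.tendsto_sum_nat
  have hterm : ∀ j, a (j + 1) ≤ S (j + (m + 1)) := fun j =>
    Finset.single_le_sum (fun i _ => ha i) (Finset.mem_Icc.2 ⟨by omega, by omega⟩)
  have hbdd : BddAbove (Set.range fun j : ℕ => a (j + 1) / S (j + (m + 1))) := by
    refine ⟨1, ?_⟩
    rintro _ ⟨j, rfl⟩
    exact div_le_one_of_le₀ (hterm j) (hS _)
  obtain ⟨u, hu0, hu1, hu⟩ := exists_inv_exp_mul_le_one_sub_mul_pow m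
  by_contra! hsup
  have hinc : ∀ j, S (j + 1) - S j ≤
      1 / (Real.exp 1 * ((m + 1 : ℕ) : ℝ)) * S (j + 1 + m) := by
    intro j
    have hj := (le_ciSup hbdd j).trans hsup
    rw [hsucc, add_sub_cancel_left, add_assoc, add_comm 1 m]
    rcases (hS (j + (m + 1))).eq_or_lt with h0 | h0
    · rw [← h0, mul_zero]
      exact (hterm j).trans h0.ge
    · exact (div_le_iff₀ h0).1 hj
  have hratio := mul_succ_le_of_increment_le hS hlim hpos hu0 hu1 hu hinc
  have hzero : ∀ n, S n ≤ 0 := by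
    intro n
    induction n with
    | zero => simp [hSdef]
    | succ n ih => exact nonpos_of_mul_nonpos_right ((hratio n).trans ih) hu0
  exact hpos.not_ge (le_of_tendsto' hlim hzero)
end

section
/- Let k ≥ 2 be an integer and s > 0 a real number. Then the inequality 1 + s·x^k > x holds for every real x > 0 if and only if s > (k−1)^{k−1} / k^k. -/
/-- The line `x - 1` lies below `c * x ^ (m + 1)` for the critical constant
`c = m ^ m / (m + 1) ^ (m + 1)`. -/
theorem sub_one_le_critical_mul_pow {m : ℕ} (hm : 0 < m) {x : ℝ} (hx : 0 ≤ x) :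
    x - 1 ≤ (m : ℝ) ^ m / ((m : ℝ) + 1) ^ (m + 1) * x ^ (m + 1) := by
  have hm' : (0 : ℝ) < m := by exact_mod_cast hm
  have ht : 0 ≤ m * x / ((m : ℝ) + 1) := by positivity
  have bernoulli := one_add_mul_sub_le_pow (by linarith : -1 ≤ m * x / ((m : ℝ) + 1)) (m + 1)
  have hl : 1 + ((m + 1 : ℕ) : ℝ) * (m * x / ((m : ℝ) + 1) - 1) = m * (x - 1) := by
    push_cast
    field_simp
    ring
  have hr : (m * x / ((m : ℝ) + 1)) ^ (m + 1) =
      m * ((m : ℝ) ^ m / ((m : ℝ) + 1) ^ (m + 1) * x ^ (m + 1)) := by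
    rw [div_pow, mul_pow, pow_succ (m : ℝ) m]
    ring
  rw [hl, hr] at bernoulli
  exact le_of_mul_le_mul_left bernoulli hm'

/-- For an integer `k ≥ 2` and a real `s > 0`, the inequality `1 + s * x ^ k > x` holds
for every real `x > 0` if and only if `s > (k - 1) ^ (k - 1) / k ^ k`. -/
theorem stmt_13 (k : ℕ) (hk : 2 ≤ k) (s : ℝ) (hs : 0 < s) :
    (∀ x : ℝ, 0 < x → x < 1 + s * x ^ k) ↔
      ((k : ℝ) - 1) ^ (k - 1) / (k : ℝ) ^ k < s := by
  obtain ⟨m, rfl⟩ : ∃ m, k = m + 1 := ⟨k - 1, by omega⟩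
  have hm : 0 < m := by omega
  have hm' : (0 : ℝ) < m := by exact_mod_cast hm
  simp only [Nat.cast_add, Nat.cast_one, add_sub_cancel_right, Nat.add_sub_cancel]
  constructor
  · intro h
    have h₀ := h (((m : ℝ) + 1) / m) (by positivity)
    have hx₀ : ((m : ℝ) + 1) / m = 1 + 1 / m := by field_simp
    have h₁ : 1 / (m : ℝ) < s * (((m : ℝ) + 1) / m) ^ (m + 1) := by linarith
    rw [div_pow, mul_div_assoc', div_lt_div_iff₀ hm' (by positivity), pow_succ (m : ℝ) m,
      one_mul] at h₁
    rw [div_lt_iff₀ (by positivity)]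
    exact lt_of_mul_lt_mul_right h₁ hm'.le
  · intro h x hx
    have h₀ := sub_one_le_critical_mul_pow hm hx.le
    have h₁ := mul_lt_mul_of_pos_right h (pow_pos hx (m + 1))
    linarith
end
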